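/- (Ball–Rivoal) There exists an odd integer ℓ with 5 ≤ ℓ ≤ 169 such that the three real numbers 1, ζ(3) and ζ(ℓ) are linearly independent over ℚ. -/

import Mathlib

/-- The values of the Riemann zeta function at integers `s ≥ 2`,
as a real number: `ζ(s) = ∑_{n ≥ 1} n^{-s}`. -/
noncomputable def zetaR (s : ℕ) : ℝ := ∑' n : ℕ, 1 / (n + 1 : ℝ) ^ s

section

open Filter Topology MeasureTheory ArithmeticFunction

theorem exists_continuousOn_LSeries_vonMangoldt_sub :
    ∃ G : ℂ → ℂ, ContinuousOn G {s | 1 ≤ s.re} ∧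
      ∀ s : ℂ, 1 < s.re → LSeries (fun n ↦ (vonMangoldt n : ℂ)) s = G s + 1 / (s - 1) := by
  refine ⟨vonMangoldt.LFunctionResidueClassAux (1 : ZMod 1),
    vonMangoldt.continuousOn_LFunctionResidueClassAux 1, fun s hs ↦ ?_⟩
  have h := vonMangoldt.eqOn_LFunctionResidueClassAux (q := 1) (a := 1) isUnit_one hs
  have e : (fun n ↦ (vonMangoldt.residueClass (1 : ZMod 1) n : ℂ)) = fun n ↦ (vonMangoldt n : ℂ) := by
    ext n
    simp [vonMangoldt.residueClass, Subsingleton.elim (n : ZMod 1) 1]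
  rw [h, e]
  simp

/-- The Fejér kernel, the Fourier transform of the triangle function. -/
noncomputable def fejerKernel (v : ℝ) : ℝ := if v = 0 then 1 else 2 * (1 - Real.cos v) / v ^ 2

theorem fejerKernel_nonneg (v : ℝ) : 0 ≤ fejerKernel v := by
  unfold fejerKernel
  split_ifs
  · exact zero_le_one
  · have := Real.cos_le_one v
    have : 0 ≤ 1 - Real.cos v := by linarith
    positivity

theorem fejerKernel_le_one (v : ℝ) : fejerKernel v ≤ 1 := by
  unfold fejerKernel
  split_ifs with h
  · exact le_rfl
  · rw [div_le_one (by positivity)]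
    have := Real.one_sub_sq_div_two_le_cos (x := v)
    linarith

theorem integral_one_sub_mul_exp {v : ℝ} (hv : v ≠ 0) :
    ∫ t in (0 : ℝ)..1, (1 - (t : ℂ)) * Complex.exp (t * v * Complex.I) =
      (Complex.exp (v * Complex.I) - 1) / (v * Complex.I) ^ 2 - 1 / (v * Complex.I) := by
  have hv' : (v : ℂ) * Complex.I ≠ 0 := by simp [hv]
  have hv0 : (v : ℂ) ≠ 0 := by simp [hv]
  have hd : ∀ t ∈ Set.uIcc (0 : ℝ) 1, HasDerivAt (fun t : ℝ ↦
      ((1 - (t : ℂ)) / (v * Complex.I) + 1 / (v * Complex.I) ^ 2) * Complex.exp (t * v * Complex.I))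
      ((1 - (t : ℂ)) * Complex.exp (t * v * Complex.I)) t := by
    intro t _
    have h1 : HasDerivAt (fun t : ℝ ↦ (t : ℂ)) 1 t := Complex.ofRealCLM.hasDerivAt
    have h2 := ((h1.mul_const (v : ℂ)).mul_const Complex.I).cexp
    have h3 := ((h1.const_sub 1).div_const (v * Complex.I)).add_const (1 / (v * Complex.I) ^ 2)
    convert! h3.mul h2 using 1
    field_simp
    ring
  rw [intervalIntegral.integral_eq_sub_of_hasDerivAt hd]
  · field_simp
    simp
    ring
  · apply Continuous.intervalIntegrable
    fun_prop

theorem integral_triangle_mul_exp (v : ℝ) :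
    ∫ t in (-1 : ℝ)..1, ((1 - |t| : ℝ) : ℂ) * Complex.exp (t * v * Complex.I) =
      fejerKernel v := by
  have hc : ∀ v : ℝ, Continuous fun t : ℝ ↦ ((1 - |t| : ℝ) : ℂ) * Complex.exp (t * v * Complex.I) := by
    intro v; fun_prop
  have h01 : ∀ v : ℝ, ∫ t in (0 : ℝ)..1, ((1 - |t| : ℝ) : ℂ) * Complex.exp (t * v * Complex.I) =
      ∫ t in (0 : ℝ)..1, (1 - (t : ℂ)) * Complex.exp (t * v * Complex.I) := by
    intro v
    refine intervalIntegral.integral_congr fun t ht ↦ ?_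
    rw [Set.uIcc_of_le zero_le_one] at ht
    simp [abs_of_nonneg ht.1]
  have h10 : ∫ t in (-1 : ℝ)..0, ((1 - |t| : ℝ) : ℂ) * Complex.exp (t * v * Complex.I) =
      ∫ t in (0 : ℝ)..1, ((1 - |t| : ℝ) : ℂ) * Complex.exp (t * (-v : ℝ) * Complex.I) := by
    have := intervalIntegral.integral_comp_neg (a := -1) (b := 0)
      (fun t : ℝ ↦ ((1 - |t| : ℝ) : ℂ) * Complex.exp (t * (-v : ℝ) * Complex.I))
    simp only [neg_zero, neg_neg] at this
    rw [← this]
    simp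
  rw [← intervalIntegral.integral_add_adjacent_intervals ((hc v).intervalIntegrable (-1) 0)
    ((hc v).intervalIntegrable 0 1), h10, h01, h01]
  by_cases hv : v = 0
  · subst hv
    have : ∫ t in (0 : ℝ)..1, (1 - (t : ℂ)) = 1 / 2 := by
      have h : ∫ t in (0 : ℝ)..1, (1 - (t : ℂ)) = ((∫ t in (0 : ℝ)..1, (1 - t) : ℝ) : ℂ) := by
        rw [← intervalIntegral.integral_ofReal]; simp
      rw [h, intervalIntegral.integral_sub (by simp) (by simp), integral_id]
      norm_num
    simp [fejerKernel, this]
    norm_num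
  · rw [integral_one_sub_mul_exp (neg_ne_zero.2 hv), integral_one_sub_mul_exp hv]
    have hv' : (v : ℂ) ≠ 0 := by simp [hv]
    simp only [fejerKernel, hv, if_false]
    have hcos := Complex.two_cos (v : ℂ)
    push_cast
    have : Complex.exp (-(v : ℂ) * Complex.I) = 2 * Complex.cos v - Complex.exp (v * Complex.I) := by
      rw [hcos]; ring
    rw [this]
    field_simp
    simp only [Complex.I_sq]
    ring

theorem integrable_fejerKernel : Integrable fejerKernel := by
  have hm : Measurable fejerKernel := by
    unfold fejerKernel
    refine Measurable.ite (measurableSet_singleton 0) measurable_const ?_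
    fun_prop
  refine (integrable_inv_one_add_sq.const_mul 5).mono' hm.aestronglyMeasurable ?_
  refine Eventually.of_forall fun v ↦ ?_
  rw [Real.norm_of_nonneg (fejerKernel_nonneg v), ← div_eq_mul_inv, le_div_iff₀ (by positivity)]
  have h1 := fejerKernel_le_one v
  have h2 : fejerKernel v * v ^ 2 ≤ 4 := by
    unfold fejerKernel
    split_ifs with h
    · simp [h]
    · rw [div_mul_cancel₀ _ (by positivity)]
      linarith [Real.neg_one_le_cos v]
  linarith

theorem continuous_fejerKernel : Continuous fejerKernel := by
  have h : fejerKernel = fun v : ℝ ↦ (∫ t in (-1 : ℝ)..1,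
      ((1 - |t| : ℝ) : ℂ) * Complex.exp (t * v * Complex.I)).re := by
    ext v; rw [integral_triangle_mul_exp]; simp
  rw [h]
  refine Complex.continuous_re.comp ?_
  apply intervalIntegral.continuous_parametric_intervalIntegral_of_continuous'
  fun_prop

theorem integral_fejerKernel_pos : 0 < ∫ v, fejerKernel v := by
  rw [integral_pos_iff_support_of_nonneg fejerKernel_nonneg integrable_fejerKernel]
  refine (continuous_fejerKernel.isOpen_support).measure_pos _ ⟨0, ?_⟩
  simp [fejerKernel]

theorem integral_triangle_mul_inv {δ : ℝ} (hδ : 0 < δ) (T y : ℝ) :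
    ∫ t in (-1 : ℝ)..1, ((1 - |t| : ℝ) : ℂ) * Complex.exp (-(T * t * y * Complex.I)) *
      (1 / ((1 + δ - T * t * Complex.I) - 1)) =
    ((∫ v in Set.Ioi (0 : ℝ), Real.exp (-δ * v) * fejerKernel (T * (v - y)) : ℝ) : ℂ) := by
  have h1 : ∀ t : ℝ, (1 / ((1 + δ - T * t * Complex.I) - 1) : ℂ) =
      ∫ v in Set.Ioi (0 : ℝ), Complex.exp ((-δ + T * t * Complex.I) * v) := by
    intro t
    rw [integral_exp_mul_complex_Ioi (by simpa using hδ)]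
    have : (-(δ : ℂ) + T * t * Complex.I) ≠ 0 := fun h ↦ by
      have := congrArg Complex.re h
      simp at this
      exact hδ.ne' this
    simp
    rw [show (1 + δ - T * t * Complex.I - 1 : ℂ) = -(-(δ : ℂ) + T * t * Complex.I) by ring]
    rw [inv_neg, neg_div, one_div]
  simp_rw [h1]
  rw [intervalIntegral.integral_of_le (by norm_num)]
  simp_rw [← integral_const_mul]
  rw [integral_integral_swap]
  · refine Eq.trans ?_ (integral_ofReal (𝕜 := ℂ))
    refine setIntegral_congr_fun measurableSet_Ioi fun v _ ↦ ?_
    simp only [RCLike.ofReal_eq_complex_ofReal]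
    rw [Complex.ofReal_mul, ← integral_triangle_mul_exp, intervalIntegral.integral_of_le (by norm_num),
      ← integral_const_mul]
    congr 1
    ext t
    rw [mul_assoc, ← Complex.exp_add, Complex.ofReal_exp, mul_left_comm, ← Complex.exp_add]
    congr 2
    push_cast
    ring
  · have hb : Integrable (fun p : ℝ × ℝ ↦ (1 : ℝ) * Real.exp (-δ * p.2))
        ((volume.restrict (Set.Ioc (-1) 1)).prod (volume.restrict (Set.Ioi 0))) :=
      Integrable.mul_prod (f := fun _ : ℝ ↦ (1 : ℝ)) (g := fun v : ℝ ↦ Real.exp (-δ * v))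
        (integrable_const _) (exp_neg_integrableOn_Ioi 0 hδ)
    refine hb.mono' (Continuous.aestronglyMeasurable (by unfold Function.uncurry; fun_prop)) ?_
    rw [Measure.prod_restrict]
    refine (ae_restrict_mem (measurableSet_Ioc.prod measurableSet_Ioi)).mono fun p hp ↦ ?_
    have hp1 : |p.1| ≤ 1 := abs_le.2 ⟨hp.1.1.le, hp.1.2⟩
    simp only [Function.uncurry, norm_mul, Complex.norm_exp, Complex.norm_real]
    have : ‖1 - |p.1|‖ ≤ 1 := by
      rw [Real.norm_of_nonneg (by linarith)]
      linarith [abs_nonneg p.1]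
    have e1 : (-(T * p.1 * y * Complex.I) : ℂ).re = 0 := by simp
    have e2 : ((-δ + T * p.1 * Complex.I) * p.2 : ℂ).re = -δ * p.2 := by simp
    rw [e1, e2, Real.exp_zero, mul_one]
    gcongr

theorem hasSum_vonMangoldt_mul_fejerKernel {δ : ℝ} (hδ : 0 < δ) (T y : ℝ) :
    HasSum (fun n : ℕ ↦ ((vonMangoldt n * (n : ℝ) ^ (-(1 + δ)) *
      fejerKernel (T * (Real.log n - y)) : ℝ) : ℂ))
    (∫ t in (-1 : ℝ)..1, ((1 - |t| : ℝ) : ℂ) * Complex.exp (-(T * t * y * Complex.I)) *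
      LSeries (fun n ↦ (vonMangoldt n : ℂ)) (1 + δ - T * t * Complex.I)) := by
  have hre : ∀ t : ℝ, (1 + δ - T * t * Complex.I : ℂ).re = 1 + δ := by intro t; simp
  have hsum : ∀ t : ℝ, LSeriesSummable (fun n ↦ (vonMangoldt n : ℂ)) (1 + δ - T * t * Complex.I) := by
    intro t
    exact LSeriesSummable_vonMangoldt (by rw [hre]; linarith)
  have hkey : ∀ n : ℕ, ((vonMangoldt n * (n : ℝ) ^ (-(1 + δ)) *
      fejerKernel (T * (Real.log n - y)) : ℝ) : ℂ) = ∫ t in (-1 : ℝ)..1,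
      ((1 - |t| : ℝ) : ℂ) * Complex.exp (-(T * t * y * Complex.I)) *
      LSeries.term (fun n ↦ (vonMangoldt n : ℂ)) (1 + δ - T * t * Complex.I) n := by
    intro n
    rcases Nat.eq_zero_or_pos n with rfl | hn
    · simp
    · have hn' : (n : ℂ) ≠ 0 := by exact_mod_cast hn.ne'
      rw [Complex.ofReal_mul, ← integral_triangle_mul_exp, ← intervalIntegral.integral_const_mul]
      congr 1
      ext t
      rw [LSeries.term_of_ne_zero hn.ne', div_eq_mul_inv, ← Complex.cpow_neg,
        Complex.cpow_def_of_ne_zero hn', Real.rpow_def_of_pos (by exact_mod_cast hn)]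
      push_cast
      rw [← Complex.natCast_log]
      have : ∀ a b c d e f : ℂ, Complex.exp c * Complex.exp d = Complex.exp e * Complex.exp f →
        a * Complex.exp c * (b * Complex.exp d) = b * Complex.exp e * (a * Complex.exp f) := by
        intro a b c d e f h
        linear_combination a * b * h
      apply this
      rw [← Complex.exp_add, ← Complex.exp_add]
      congr 1
      ring
  simp_rw [hkey]
  have hs0 := (hsum 0).norm
  refine intervalIntegral.hasSum_integral_of_dominated_convergence
    (fun n _ ↦ ‖LSeries.term (fun n ↦ (vonMangoldt n : ℂ)) (1 + δ - T * (0 : ℝ) * Complex.I) n‖) ?_ ?_ ?_ ?_ ?_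
  · intro n
    apply Continuous.aestronglyMeasurable
    rcases Nat.eq_zero_or_pos n with rfl | hn
    · simp only [LSeries.term_zero]; fun_prop
    · simp only [LSeries.term_of_ne_zero hn.ne', div_eq_mul_inv]
      have : (n : ℂ) ≠ 0 := by exact_mod_cast hn.ne'
      simp_rw [← Complex.cpow_neg, Complex.cpow_def_of_ne_zero this]
      fun_prop
  · intro n
    refine Eventually.of_forall fun t ht ↦ ?_
    rw [Set.uIoc_of_le (by norm_num)] at ht
    have ht1 : |t| ≤ 1 := abs_le.2 ⟨ht.1.le, ht.2⟩
    rw [norm_mul, norm_mul, Complex.norm_exp, Complex.norm_real]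
    have : ‖1 - |t|‖ ≤ 1 := by
      rw [Real.norm_of_nonneg (by linarith)]
      linarith [abs_nonneg t]
    have e1 : (-(T * t * y * Complex.I) : ℂ).re = 0 := by simp
    rw [e1, Real.exp_zero, mul_one, LSeries.norm_term_eq, LSeries.norm_term_eq, hre, hre]
    refine mul_le_of_le_one_left ?_ this
    split_ifs
    · exact le_rfl
    · positivity
  · exact Eventually.of_forall fun t _ ↦ hs0
  · simp
  · exact Eventually.of_forall fun t _ ↦ ((hsum t).hasSum).mul_left _

theorem setIntegral_exp_mul_fejerKernel_le {δ T : ℝ} (hδ : 0 < δ) (hT : 0 < T) (y : ℝ) :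
    ∫ v in Set.Ioi (0 : ℝ), Real.exp (-δ * v) * fejerKernel (T * (v - y)) ≤
      (∫ v, fejerKernel v) / T := by
  have hi : Integrable fun v ↦ fejerKernel (T * (v - y)) :=
    (integrable_fejerKernel.comp_mul_left' hT.ne').comp_sub_right y
  have hle : ∀ v ∈ Set.Ioi (0 : ℝ), Real.exp (-δ * v) * fejerKernel (T * (v - y)) ≤
      fejerKernel (T * (v - y)) := by
    intro v hv
    refine mul_le_of_le_one_left (fejerKernel_nonneg _) (Real.exp_le_one_iff.2 ?_)
    have : 0 < v := hv
    nlinarith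
  calc _ ≤ ∫ v in Set.Ioi (0 : ℝ), fejerKernel (T * (v - y)) := by
        refine setIntegral_mono_on ?_ hi.integrableOn measurableSet_Ioi hle
        refine (hi.integrableOn (s := Set.Ioi 0)).mono' ?_ ?_
        · refine Continuous.aestronglyMeasurable ?_
          have := continuous_fejerKernel
          fun_prop
        · refine (ae_restrict_mem measurableSet_Ioi).mono fun v hv ↦ ?_
          rw [Real.norm_of_nonneg (mul_nonneg (Real.exp_pos _).le (fejerKernel_nonneg _))]
          exact hle v hv
    _ ≤ ∫ v, fejerKernel (T * (v - y)) :=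
        setIntegral_le_integral hi (Eventually.of_forall fun v ↦ fejerKernel_nonneg _)
    _ = _ := by
        rw [integral_sub_right_eq_self (fun v ↦ fejerKernel (T * v)) y,
          Measure.integral_comp_mul_left, abs_of_pos (inv_pos.2 hT), smul_eq_mul]
        field_simp

theorem exists_sum_vonMangoldt_mul_fejerKernel_le {T : ℝ} (hT : 0 < T) :
    ∃ E : ℝ → ℝ, Tendsto E atTop (𝓝 0) ∧ ∀ (y : ℝ) (s : Finset ℕ),
      ∑ n ∈ s, vonMangoldt n / n * fejerKernel (T * (Real.log n - y)) ≤
        (∫ v, fejerKernel v) / T + E y := by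
  obtain ⟨G, hG, hFG⟩ := exists_continuousOn_LSeries_vonMangoldt_sub
  have hcont : ∀ δ : ℝ, 0 ≤ δ → Continuous fun t : ℝ ↦ G (1 + δ - T * t * Complex.I) := by
    intro δ hδ
    refine hG.comp_continuous (by fun_prop) fun t ↦ ?_
    simpa using hδ
  refine ⟨fun y ↦ ‖∫ t in (-1 : ℝ)..1, ((1 - |t| : ℝ) : ℂ) * Complex.exp (-(T * t * y * Complex.I)) *
    G (1 + (0 : ℝ) - T * t * Complex.I)‖, ?_, fun y s ↦ ?_⟩
  · have h := (Real.tendsto_integral_exp_smul_cocompact (Set.indicator (Set.Ioc (-1 : ℝ) 1)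
      fun t : ℝ ↦ ((1 - |t| : ℝ) : ℂ) * G (1 + (0 : ℝ) - T * t * Complex.I))).norm
    rw [norm_zero] at h
    have hy : Tendsto (fun y : ℝ ↦ T * y / (2 * Real.pi)) atTop (cocompact ℝ) := by
      refine Tendsto.mono_right ?_ atTop_le_cocompact
      exact (tendsto_id.const_mul_atTop hT).atTop_div_const (by positivity)
    refine (h.comp hy).congr fun y ↦ ?_
    simp only [Function.comp]
    rw [intervalIntegral.integral_of_le (by norm_num), ← integral_indicator measurableSet_Ioc]
    congr 2
    ext t
    by_cases ht : t ∈ Set.Ioc (-1 : ℝ) 1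
    · rw [Set.indicator_of_mem ht, Set.indicator_of_mem ht, Circle.smul_def, Real.fourierChar_apply,
        smul_eq_mul]
      have : (((2 * Real.pi * -(t * (T * y / (2 * Real.pi))) : ℝ) : ℂ) * Complex.I) =
          -(T * t * y * Complex.I) := by
        have hpi : (Real.pi : ℂ) ≠ 0 := by exact_mod_cast Real.pi_ne_zero
        push_cast
        field_simp
      rw [this]
      ring
    · rw [Set.indicator_of_notMem ht, Set.indicator_of_notMem ht, smul_zero]
  · have hmain : ∀ δ : ℝ, 0 < δ → ∑ n ∈ s, vonMangoldt n * (n : ℝ) ^ (-(1 + δ)) *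
        fejerKernel (T * (Real.log n - y)) ≤ (∫ v, fejerKernel v) / T +
        ‖∫ t in (-1 : ℝ)..1, ((1 - |t| : ℝ) : ℂ) * Complex.exp (-(T * t * y * Complex.I)) *
          G (1 + δ - T * t * Complex.I)‖ := by
      intro δ hδ
      have h1 := hasSum_vonMangoldt_mul_fejerKernel hδ T y
      have h2 : ∫ t in (-1 : ℝ)..1, ((1 - |t| : ℝ) : ℂ) * Complex.exp (-(T * t * y * Complex.I)) *
          LSeries (fun n ↦ (vonMangoldt n : ℂ)) (1 + δ - T * t * Complex.I) =
          (∫ t in (-1 : ℝ)..1, ((1 - |t| : ℝ) : ℂ) * Complex.exp (-(T * t * y * Complex.I)) *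
            G (1 + δ - T * t * Complex.I)) +
          ((∫ v in Set.Ioi (0 : ℝ), Real.exp (-δ * v) * fejerKernel (T * (v - y)) : ℝ) : ℂ) := by
        rw [← integral_triangle_mul_inv hδ, ← intervalIntegral.integral_add]
        · congr 1
          ext t
          rw [hFG _ (by simpa using hδ)]
          ring
        · exact (Continuous.mul (by fun_prop) (hcont δ hδ.le)).intervalIntegrable _ _
        · apply Continuous.intervalIntegrable
          refine Continuous.mul (by fun_prop) (Continuous.div (by fun_prop) (by fun_prop) fun t h ↦ ?_)
          have := congrArg Complex.re h
          simp at this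
          exact hδ.ne' this
      rw [h2] at h1
      have h3 := Complex.hasSum_re h1
      simp only [Complex.ofReal_re, Complex.add_re] at h3
      refine (sum_le_hasSum s (fun n _ ↦ ?_) h3).trans ?_
      · exact mul_nonneg (mul_nonneg vonMangoldt_nonneg (Real.rpow_nonneg (Nat.cast_nonneg n) _))
          (fejerKernel_nonneg _)
      · rw [add_comm]
        exact add_le_add (setIntegral_exp_mul_fejerKernel_le hδ hT y) (Complex.re_le_norm _)
    have hl : Tendsto (fun δ : ℝ ↦ ∑ n ∈ s, vonMangoldt n * (n : ℝ) ^ (-(1 + δ)) *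
        fejerKernel (T * (Real.log n - y))) (𝓝[>] 0)
        (𝓝 (∑ n ∈ s, vonMangoldt n / n * fejerKernel (T * (Real.log n - y)))) := by
      refine tendsto_finsetSum _ fun n _ ↦ Tendsto.mul_const _ ?_
      rcases Nat.eq_zero_or_pos n with rfl | hn
      · simp
      · have hc : ContinuousAt (fun δ : ℝ ↦ vonMangoldt n * (n : ℝ) ^ (-(1 + δ))) 0 := by
          refine ContinuousAt.mul continuousAt_const (ContinuousAt.rpow continuousAt_const (by fun_prop) (Or.inl ?_))
          exact_mod_cast hn.ne'
        have := hc.tendsto.mono_left (nhdsWithin_le_nhds (s := Set.Ioi 0))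
        simpa [Real.rpow_neg_one, div_eq_mul_inv] using this
    have hr : Tendsto (fun δ : ℝ ↦ ∫ t in (-1 : ℝ)..1, ((1 - |t| : ℝ) : ℂ) *
        Complex.exp (-(T * t * y * Complex.I)) * G (1 + δ - T * t * Complex.I)) (𝓝[>] 0)
        (𝓝 (∫ t in (-1 : ℝ)..1, ((1 - |t| : ℝ) : ℂ) *
        Complex.exp (-(T * t * y * Complex.I)) * G (1 + (0 : ℝ) - T * t * Complex.I))) := by
      have hco : ContinuousOn (fun p : ℝ × ℝ ↦ G (1 + p.1 - T * p.2 * Complex.I))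
          (Set.Icc 0 1 ×ˢ Set.Icc (-1) 1) := by
        refine hG.comp (by fun_prop) fun p hp ↦ ?_
        simpa using hp.1.1
      obtain ⟨M, hM⟩ := (isCompact_Icc.prod isCompact_Icc).exists_bound_of_continuousOn hco
      have h01 : ∀ᶠ δ : ℝ in 𝓝[>] 0, δ ∈ Set.Ioc (0 : ℝ) 1 := Ioc_mem_nhdsGT zero_lt_one
      refine intervalIntegral.tendsto_integral_filter_of_dominated_convergence (fun _ ↦ M) ?_ ?_ ?_ ?_
      · filter_upwards [h01] with δ hδ
        exact (Continuous.mul (by fun_prop) (hcont δ hδ.1.le)).aestronglyMeasurable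
      · filter_upwards [h01] with δ hδ
        refine Eventually.of_forall fun t ht ↦ ?_
        rw [Set.uIoc_of_le (by norm_num)] at ht
        have ht1 : |t| ≤ 1 := abs_le.2 ⟨ht.1.le, ht.2⟩
        have := hM (δ, t) ⟨⟨hδ.1.le, hδ.2⟩, ⟨ht.1.le, ht.2⟩⟩
        rw [norm_mul, norm_mul, Complex.norm_exp, Complex.norm_real]
        have h2 : ‖1 - |t|‖ ≤ 1 := by
          rw [Real.norm_of_nonneg (by linarith)]
          linarith [abs_nonneg t]
        have e1 : (-(T * t * y * Complex.I) : ℂ).re = 0 := by simp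
        rw [e1, Real.exp_zero, mul_one]
        exact (mul_le_of_le_one_left (norm_nonneg _) h2).trans this
      · simp
      · refine Eventually.of_forall fun t ht ↦ Tendsto.const_mul _ ?_
        have hc : ContinuousOn (fun δ : ℝ ↦ G (1 + δ - T * t * Complex.I)) (Set.Ici 0) := by
          refine hG.comp (by fun_prop) fun δ hδ ↦ ?_
          simpa using hδ
        exact ((hc 0 Set.self_mem_Ici).mono Set.Ioi_subset_Ici_self).tendsto
    refine le_of_tendsto_of_tendsto hl (hr.norm.const_add _) ?_
    filter_upwards [self_mem_nhdsWithin] with δ hδ using hmain δ hδ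

theorem tendsto_intervalIntegral_fejerKernel {η : ℝ} (hη : 0 < η) :
    Tendsto (fun T : ℝ ↦ ∫ v in (-(T * η))..(T * η), fejerKernel v) atTop (𝓝 (∫ v, fejerKernel v)) :=
  intervalIntegral_tendsto_integral integrable_fejerKernel
    (tendsto_neg_atTop_atBot.comp (tendsto_id.atTop_mul_const hη)) (tendsto_id.atTop_mul_const hη)

theorem le_integral_exp_mul_fejerKernel {T η a b l : ℝ} (hT : 0 < T) (hη : 0 < η)
    (ha : a ≤ l - η) (hb : l + η ≤ b) :
    Real.exp (l - η) * ((∫ v in (-(T * η))..(T * η), fejerKernel v) / T) ≤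
      ∫ y in a..b, Real.exp y * fejerKernel (T * (l - y)) := by
  have hcf := continuous_fejerKernel
  have h1 : ∫ y in (l - η)..(l + η), Real.exp (l - η) * fejerKernel (T * (l - y)) =
      Real.exp (l - η) * ((∫ v in (-(T * η))..(T * η), fejerKernel v) / T) := by
    rw [intervalIntegral.integral_const_mul]
    have := intervalIntegral.integral_comp_sub_mul (a := l - η) (b := l + η) fejerKernel hT.ne' (T * l)
    have e : ∀ y, T * (l - y) = T * l - T * y := fun y ↦ by ring
    simp_rw [e]
    rw [this, smul_eq_mul]
    rw [show T * l - T * (l + η) = -(T * η) by ring, show T * l - T * (l - η) = T * η by ring]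
    ring
  rw [← h1]
  calc _ ≤ ∫ y in (l - η)..(l + η), Real.exp y * fejerKernel (T * (l - y)) := by
        refine intervalIntegral.integral_mono_on (by linarith) ?_ ?_ fun y hy ↦ ?_
        · exact Continuous.intervalIntegrable (by fun_prop) _ _
        · exact Continuous.intervalIntegrable (by fun_prop) _ _
        · have := hy.1
          gcongr
          exact fejerKernel_nonneg _
    _ ≤ _ := by
        refine intervalIntegral.integral_mono_interval ha (by linarith) hb ?_ ?_
        · exact Eventually.of_forall fun y ↦ mul_nonneg (Real.exp_pos _).le (fejerKernel_nonneg _)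
        · exact Continuous.intervalIntegrable (by fun_prop) _ _

theorem sum_vonMangoldt_le_of_fejerKernel {T η A Y ε c : ℝ} (hT : 0 < T) (hη : 0 < η)
    (hAY : A ≤ Y) {s : Finset ℕ} (hs : ∀ n ∈ s, 0 < n ∧ A + η ≤ Real.log n ∧ Real.log n ≤ Y - η)
    (hE : ∀ y, A ≤ y → ∑ n ∈ s, vonMangoldt n / n * fejerKernel (T * (Real.log n - y)) ≤ c / T + ε)
    (hc : 0 ≤ c / T + ε) :
    (∑ n ∈ s, vonMangoldt n) * (∫ v in (-(T * η))..(T * η), fejerKernel v) ≤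
      Real.exp (Y + η) * (c + ε * T) := by
  have hcf := continuous_fejerKernel
  set κ := ∫ v in (-(T * η))..(T * η), fejerKernel v with hκ
  have h1 : ∫ y in A..Y, Real.exp y * ∑ n ∈ s, vonMangoldt n / n * fejerKernel (T * (Real.log n - y)) ≤
      ∫ y in A..Y, Real.exp y * (c / T + ε) := by
    refine intervalIntegral.integral_mono_on hAY ?_ ?_ fun y hy ↦ ?_
    · exact Continuous.intervalIntegrable (by fun_prop) _ _
    · exact Continuous.intervalIntegrable (by fun_prop) _ _
    · have := hE y hy.1
      gcongr
  have h2 : ∫ y in A..Y, Real.exp y * (c / T + ε) ≤ Real.exp Y * (c / T + ε) := by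
    rw [intervalIntegral.integral_mul_const, integral_exp]
    gcongr
    linarith [Real.exp_pos A]
  have h3 : ∑ n ∈ s, vonMangoldt n * (Real.exp (-η) * (κ / T)) ≤
      ∫ y in A..Y, Real.exp y * ∑ n ∈ s, vonMangoldt n / n * fejerKernel (T * (Real.log n - y)) := by
    simp_rw [Finset.mul_sum]
    rw [intervalIntegral.integral_finsetSum]
    · refine Finset.sum_le_sum fun n hn ↦ ?_
      obtain ⟨h0, hl, hu⟩ := hs n hn
      have h0' : (0 : ℝ) < n := by exact_mod_cast h0
      have e : ∀ y, Real.exp y * (vonMangoldt n / n * fejerKernel (T * (Real.log n - y))) =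
          vonMangoldt n / n * (Real.exp y * fejerKernel (T * (Real.log n - y))) := fun y ↦ by ring
      simp_rw [e]
      rw [intervalIntegral.integral_const_mul]
      have := le_integral_exp_mul_fejerKernel (a := A) (b := Y) (l := Real.log n) hT hη
        (by linarith) (by linarith)
      rw [sub_eq_add_neg, Real.exp_add, Real.exp_log h0'] at this
      calc vonMangoldt n * (Real.exp (-η) * (κ / T)) =
          vonMangoldt n / n * (n * Real.exp (-η) * (κ / T)) := by field_simp
        _ ≤ _ := mul_le_mul_of_nonneg_left this (div_nonneg vonMangoldt_nonneg h0'.le)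
    · exact fun n _ ↦ Continuous.intervalIntegrable (by fun_prop) _ _
  have h4 := h3.trans (h1.trans h2)
  rw [← Finset.sum_mul] at h4
  have h5 := mul_le_mul_of_nonneg_left h4 (mul_nonneg (Real.exp_pos η).le hT.le)
  calc _ = Real.exp η * T * ((∑ n ∈ s, vonMangoldt n) * (Real.exp (-η) * (κ / T))) := by
        rw [Real.exp_neg]; field_simp
    _ ≤ _ := h5
    _ = _ := by rw [Real.exp_add]; field_simp

theorem eventually_psi_le_mul {C : ℝ} (hC : 1 < C) : ∀ᶠ n : ℕ in atTop, Chebyshev.psi n ≤ C * n := by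
  set c := ∫ v, fejerKernel v with hc
  have hc0 : 0 < c := integral_fejerKernel_pos
  set η := Real.log C / 4 with hη
  have hlog : 0 < Real.log C := Real.log_pos hC
  have hη0 : 0 < η := by positivity
  have hexp : Real.exp (4 * η) = C := by
    rw [hη, mul_div_cancel₀ _ (by norm_num), Real.exp_log (by linarith)]
  have h2 : 1 < Real.exp (2 * η) := Real.one_lt_exp_iff.2 (by linarith)
  have hsq : Real.exp (2 * η) * Real.exp (2 * η) = C := by rw [← Real.exp_add, ← hexp]; ring_nf
  have hlt : c / Real.exp (2 * η) < c := div_lt_self hc0 h2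
  obtain ⟨T, hκ, hT⟩ := (((tendsto_intervalIntegral_fejerKernel hη0).eventually (lt_mem_nhds hlt)).and
    (eventually_gt_atTop 0)).exists
  set κ := ∫ v in (-(T * η))..(T * η), fejerKernel v with hκd
  have hκ0 : 0 < κ := lt_trans (by positivity) hκ
  have hκc : c < κ * Real.exp (2 * η) := (div_lt_iff₀ (Real.exp_pos _)).1 hκ
  set ε := (κ * Real.exp (2 * η) - c) / (2 * T) with hε
  have hε0 : 0 < ε := div_pos (by linarith) (by linarith)
  obtain ⟨E, hE0, hE⟩ := exists_sum_vonMangoldt_mul_fejerKernel_le hT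
  obtain ⟨A, hA⟩ := eventually_atTop.1 (hE0.eventually (gt_mem_nhds hε0))
  set D := Real.exp (2 * η) * (c + ε * T) / κ with hD
  have hDC : D < C := by
    rw [hD, div_lt_iff₀ hκ0, ← hsq]
    have : c + ε * T < κ * Real.exp (2 * η) := by
      have : ε * T = (κ * Real.exp (2 * η) - c) / 2 := by rw [hε]; field_simp
      linarith
    nlinarith [Real.exp_pos (2 * η)]
  obtain ⟨N, hN⟩ : ∃ N : ℕ, Real.exp (A + η) ≤ N := exists_nat_ge _
  have hlim : ∀ᶠ n : ℕ in atTop, Chebyshev.psi N ≤ (C - D) * n :=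
    (tendsto_natCast_atTop_atTop.const_mul_atTop (by linarith : 0 < C - D)).eventually_ge_atTop _
  have hlim2 : ∀ᶠ n : ℕ in atTop, Real.exp A ≤ n := tendsto_natCast_atTop_atTop.eventually_ge_atTop _
  filter_upwards [hlim, hlim2, eventually_ge_atTop N, eventually_gt_atTop 0] with n hn hnA hNn hn0
  have hn0' : (0 : ℝ) < n := by exact_mod_cast hn0
  have hNpos : 0 < N := by
    have := (Real.exp_pos (A + η)).trans_le hN
    exact_mod_cast this
  have hsplit : Chebyshev.psi n = Chebyshev.psi N + ∑ k ∈ Finset.Ioc N n, vonMangoldt k := by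
    simp only [Chebyshev.psi, Nat.floor_natCast]
    rw [Finset.sum_Ioc_consecutive _ (Nat.zero_le N) hNn]
  have hAl : A ≤ Real.log n := (Real.le_log_iff_exp_le hn0').2 hnA
  have hkey := sum_vonMangoldt_le_of_fejerKernel (T := T) (η := η) (A := A) (Y := Real.log n + η)
    (ε := ε) (c := c) (s := Finset.Ioc N n) hT hη0 (by linarith) (fun k hk ↦ ?_)
    (fun y hy ↦ (hE y _).trans (by linarith [hA y hy])) (by positivity)
  · rw [show Real.log n + η + η = Real.log n + 2 * η by ring, Real.exp_add, Real.exp_log hn0'] at hkey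
    have : ∑ k ∈ Finset.Ioc N n, vonMangoldt k ≤ D * n := by
      rw [hD, div_mul_eq_mul_div, le_div_iff₀ hκ0]
      linarith
    rw [hsplit]
    linarith
  · obtain ⟨h1, h2⟩ := Finset.mem_Ioc.1 hk
    have hk0 : 0 < k := hNpos.trans h1
    have hk0' : (0 : ℝ) < k := by exact_mod_cast hk0
    refine ⟨hk0, ?_, ?_⟩
    · rw [Real.le_log_iff_exp_le hk0']
      exact hN.trans (by exact_mod_cast h1.le)
    · rw [add_sub_cancel_right]
      exact Real.log_le_log hk0' (by exact_mod_cast h2)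

theorem eventually_lcmUpto_le_pow {C : ℝ} (hC : Real.exp 1 < C) :
    ∀ᶠ n : ℕ in atTop, (Nat.lcmUpto n : ℝ) ≤ C ^ n := by
  have hC0 : 0 < C := (Real.exp_pos 1).trans hC
  have h1 : 1 < Real.log C := (Real.lt_log_iff_exp_lt hC0).2 hC
  filter_upwards [eventually_psi_le_mul h1] with n hn
  rw [Chebyshev.psi_eq_log_lcmUpto, Real.log_le_iff_le_exp (by exact_mod_cast Nat.lcmUpto_pos n)] at hn
  refine hn.trans_eq ?_
  rw [mul_comm, Real.exp_nat_mul, Real.exp_log hC0]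

end

section

open Finset

/-- The product `C(n,k) C(n+k,k)`, whose squares sum to the Apéry numbers. -/
def aperyBinom (n k : ℕ) : ℚ := n.choose k * (n + k).choose k

/-- The inner coefficient of Apéry's approximations to `ζ(3)`. -/
def aperyCoeff (n k : ℕ) : ℚ := ∑ m ∈ range n, 1 / ((m : ℚ) + 1) ^ 3 +
  ∑ m ∈ range k, (-1) ^ m / (2 * ((m : ℚ) + 1) ^ 3 * aperyBinom n (m + 1))

theorem aperyBinom_eq (k j : ℕ) : aperyBinom (k + j) k =
    ((2 * k + j).factorial : ℚ) / ((k.factorial : ℚ) ^ 2 * j.factorial) := by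
  unfold aperyBinom
  rw [Nat.choose_symm_add, Nat.add_choose, Nat.add_choose,
    Nat.cast_div (Nat.factorial_mul_factorial_dvd_factorial_add k j) (by positivity),
    Nat.cast_div (Nat.factorial_mul_factorial_dvd_factorial_add (k + j) k) (by positivity),
    show k + j + k = 2 * k + j by ring]
  have := (k + j).factorial_ne_zero
  push_cast
  field_simp

theorem aperyBinom_eq_zero {n k : ℕ} (h : n < k) : aperyBinom n k = 0 := by
  simp [aperyBinom, Nat.choose_eq_zero_of_lt h]

theorem aperyBinom_zero (n : ℕ) : aperyBinom n 0 = 1 := by simp [aperyBinom]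

theorem aperyCoeff_succ_right (n k : ℕ) : aperyCoeff n (k + 1) = aperyCoeff n k +
    (-1) ^ k / (2 * ((k : ℚ) + 1) ^ 3 * aperyBinom n (k + 1)) := by
  simp only [aperyCoeff, sum_range_succ]
  ring

theorem aperyCoeff_succ_left (k j : ℕ) : aperyCoeff (k + j + 1) k = aperyCoeff (k + j) k +
    (-1) ^ k * (k.factorial : ℚ) ^ 2 * j.factorial /
      (((k : ℚ) + j + 1) ^ 2 * (2 * k + j + 1).factorial) := by
  induction k generalizing j with
  | zero =>
    simp only [aperyCoeff, sum_range_succ, range_zero, sum_empty, Nat.factorial_succ, zero_add,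
      Nat.mul_zero, Nat.factorial_zero]
    have := j.factorial_ne_zero
    push_cast
    field_simp
    ring
  | succ k ih =>
    have h := ih (j + 1)
    rw [aperyCoeff_succ_right, aperyCoeff_succ_right, show k + 1 + j = k + (j + 1) by ring, h,
      show k + (j + 1) + 1 = k + 1 + (j + 1) by ring, aperyBinom_eq (k + 1) (j + 1),
      show k + (j + 1) = k + 1 + j by ring, aperyBinom_eq (k + 1) j]
    simp only [show 2 * (k + 1) + (j + 1) = 2 * k + j + 3 by ring,
      show 2 * k + (j + 1) + 1 = 2 * k + j + 2 by ring,
      show 2 * (k + 1) + j = 2 * k + j + 2 by ring, Nat.factorial_succ]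
    have h1 := k.factorial_ne_zero
    have h2 := j.factorial_ne_zero
    have h3 := (2 * k + j).factorial_ne_zero
    push_cast
    field_simp
    ring

/-- Zeilberger's certificate for the recurrence of the Apéry numbers. -/
def aperyCert (n k : ℕ) : ℚ :=
  4 * (2 * n + 1) * (k * (2 * k + 1) - (2 * n + 1) ^ 2) * aperyBinom n k ^ 2

/-- The middle coefficient of the Apéry recurrence. -/
def aperyPoly (n : ℚ) : ℚ := 34 * n ^ 3 + 51 * n ^ 2 + 27 * n + 5

theorem aperyBinom_telescope (n k : ℕ) :
    aperyCert (n + 1) (k + 1) - aperyCert (n + 1) k = (n + 2) ^ 3 * aperyBinom (n + 2) (k + 1) ^ 2 -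
      aperyPoly (n + 1) * aperyBinom (n + 1) (k + 1) ^ 2 +
      (n + 1) ^ 3 * aperyBinom n (k + 1) ^ 2 := by
  unfold aperyCert aperyPoly
  rcases lt_trichotomy k n with h | h | h
  · obtain ⟨j, rfl⟩ := Nat.exists_eq_add_of_lt h
    have e1 := aperyBinom_eq (k + 1) (j + 1)
    have e2 := aperyBinom_eq k (j + 2)
    have e3 := aperyBinom_eq (k + 1) (j + 2)
    have e4 := aperyBinom_eq (k + 1) j
    rw [show k + j + 1 + 1 = k + 1 + (j + 1) by ring, e1,
      show k + 1 + (j + 1) = k + (j + 2) by ring, e2,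
      show k + j + 1 + 2 = k + 1 + (j + 2) by ring, e3,
      show k + j + 1 = k + 1 + j by omega, e4]
    simp only [show 2 * (k + 1) + (j + 1) = 2 * k + j + 3 by ring,
      show 2 * k + (j + 2) = 2 * k + j + 2 by ring,
      show 2 * (k + 1) + (j + 2) = 2 * k + j + 4 by ring,
      show 2 * (k + 1) + j = 2 * k + j + 2 by ring, Nat.factorial_succ]
    have h1 := k.factorial_ne_zero
    have h2 := j.factorial_ne_zero
    have h3 := (2 * k + j).factorial_ne_zero
    push_cast
    field_simp
    ring
  · subst h
    have e2 := aperyBinom_eq k 1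
    have e3 := aperyBinom_eq (k + 1) 1
    have e1 := aperyBinom_eq (k + 1) 0
    rw [aperyBinom_eq_zero (Nat.lt_succ_self k), e2, show k + 2 = k + 1 + 1 by ring, e3,
      ← Nat.add_zero (k + 1), e1]
    simp only [Nat.add_zero, show 2 * (k + 1) = 2 * k + 2 by ring, Nat.factorial_succ,
      Nat.factorial_zero]
    have h1 := k.factorial_ne_zero
    have h3 := (2 * k).factorial_ne_zero
    push_cast
    field_simp
    ring
  · rcases Nat.lt_or_ge (n + 1) k with h' | h'
    · rw [aperyBinom_eq_zero (by omega), aperyBinom_eq_zero (by omega),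
        aperyBinom_eq_zero (by omega), aperyBinom_eq_zero (by omega)]
      ring
    · obtain rfl : k = n + 1 := by omega
      have e1 := aperyBinom_eq (n + 1) 0
      have e2 := aperyBinom_eq (n + 2) 0
      rw [aperyBinom_eq_zero (by omega : n + 1 < n + 1 + 1),
        aperyBinom_eq_zero (by omega : n < n + 1 + 1), show n + 1 + 1 = n + 2 by ring,
        ← Nat.add_zero (n + 1), e1, ← Nat.add_zero (n + 2), e2]
      simp only [Nat.add_zero, show 2 * (n + 2) = 2 * n + 4 by ring,
        show 2 * (n + 1) = 2 * n + 2 by ring, Nat.factorial_succ, Nat.factorial_zero]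
      have h1 := n.factorial_ne_zero
      have h3 := (2 * n).factorial_ne_zero
      push_cast
      field_simp
      ring

/-- The certificate for the recurrence of the numerators of Apéry's approximations. -/
def aperyCert' (n k : ℕ) : ℚ := aperyCert n k * aperyCoeff n k -
  5 * (2 * n + 1) * (-1) ^ k * k / (n * (n + 1)) * aperyBinom n k

theorem aperyBinom_mul_aperyCoeff_telescope (n k : ℕ) :
    aperyCert' (n + 1) (k + 1) - aperyCert' (n + 1) k =
      (n + 2) ^ 3 * (aperyBinom (n + 2) (k + 1) ^ 2 * aperyCoeff (n + 2) (k + 1)) -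
      aperyPoly (n + 1) * (aperyBinom (n + 1) (k + 1) ^ 2 * aperyCoeff (n + 1) (k + 1)) +
      (n + 1) ^ 3 * (aperyBinom n (k + 1) ^ 2 * aperyCoeff n (k + 1)) := by
  have ht := aperyBinom_telescope n k
  unfold aperyCert'
  rcases lt_trichotomy k n with h | h | h
  · obtain ⟨j, rfl⟩ := Nat.exists_eq_add_of_lt h
    have e1 := aperyBinom_eq (k + 1) (j + 1)
    have e2 := aperyBinom_eq k (j + 2)
    have e3 := aperyBinom_eq (k + 1) (j + 2)
    have e4 := aperyBinom_eq (k + 1) j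
    have c1 := aperyCoeff_succ_left (k + 1) (j + 1)
    have c2 := aperyCoeff_succ_left (k + 1) j
    have c3 := aperyCoeff_succ_right (k + j + 1 + 1) k
    have ht' : aperyCert (k + j + 1 + 1) (k + 1) = _ := eq_add_of_sub_eq ht
    rw [ht']
    unfold aperyCert aperyPoly at *
    rw [show k + 1 + (j + 1) = k + j + 1 + 1 by ring] at e1 c1
    rw [show k + (j + 2) = k + j + 1 + 1 by ring] at e2
    rw [show k + 1 + (j + 2) = k + j + 1 + 2 by ring] at e3
    rw [show k + 1 + j = k + j + 1 by ring] at e4 c2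
    rw [show k + j + 1 + 1 + 1 = k + j + 1 + 2 by ring] at c1
    rw [e1] at c3
    have c3' : aperyCoeff (k + j + 1 + 1) k = _ := (sub_eq_of_eq_add c3).symm
    have c2' : aperyCoeff (k + j + 1) (k + 1) = _ := (sub_eq_of_eq_add c2).symm
    rw [c3', c1, c2', e1, e2, e3, e4]
    generalize aperyCoeff (k + j + 1 + 1) (k + 1) = c
    simp only [show 2 * (k + 1) + (j + 1) = 2 * k + j + 3 by ring,
      show 2 * k + (j + 2) = 2 * k + j + 2 by ring,
      show 2 * (k + 1) + (j + 2) = 2 * k + j + 4 by ring,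
      show 2 * (k + 1) + j = 2 * k + j + 2 by ring, Nat.factorial_succ]
    have h1 := k.factorial_ne_zero
    have h2 := j.factorial_ne_zero
    have h3 := (2 * k + j).factorial_ne_zero
    rw [pow_succ (-1 : ℚ) k]
    have hs : ((-1 : ℚ) ^ k) ^ 2 = 1 := by rw [← pow_mul, mul_comm, pow_mul]; simp
    generalize (-1 : ℚ) ^ k = s at *
    push_cast
    field_simp
    ring
  · subst h
    have e2 := aperyBinom_eq k 1
    have e3 := aperyBinom_eq (k + 1) 1
    have e1 := aperyBinom_eq (k + 1) 0
    have c1 := aperyCoeff_succ_left (k + 1) 0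
    have c3 := aperyCoeff_succ_right (k + 1) k
    have ht' : aperyCert (k + 1) (k + 1) = _ := eq_add_of_sub_eq ht
    rw [ht']
    unfold aperyCert aperyPoly at *
    simp only [Nat.add_zero] at e1 c1
    rw [e1] at c3
    have c3' : aperyCoeff (k + 1) k = _ := (sub_eq_of_eq_add c3).symm
    rw [aperyBinom_eq_zero (Nat.lt_succ_self k), show k + 2 = k + 1 + 1 by ring, c3', c1, e1, e2, e3]
    generalize aperyCoeff (k + 1) (k + 1) = c
    simp only [show 2 * (k + 1) = 2 * k + 2 by ring, Nat.factorial_succ, Nat.factorial_zero]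
    have h1 := k.factorial_ne_zero
    have h3 := (2 * k).factorial_ne_zero
    rw [pow_succ (-1 : ℚ) k]
    generalize (-1 : ℚ) ^ k = s at *
    push_cast
    field_simp
    ring
  · rcases Nat.lt_or_ge (n + 1) k with h' | h'
    · simp only [aperyCert]
      rw [aperyBinom_eq_zero (by omega), aperyBinom_eq_zero (by omega),
        aperyBinom_eq_zero (by omega), aperyBinom_eq_zero (by omega)]
      ring
    · obtain rfl : k = n + 1 := by omega
      have e1 := aperyBinom_eq (n + 1) 0
      have e2 := aperyBinom_eq (n + 2) 0
      have c1 := aperyCoeff_succ_left (n + 1) 0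
      have c3 := aperyCoeff_succ_right (n + 2) (n + 1)
      simp only [Nat.add_zero] at e1 e2 c1
      rw [show n + 1 + 1 = n + 2 by ring] at c1 c3 ht ⊢
      rw [c3, c1]
      unfold aperyCert
      rw [aperyBinom_eq_zero (by omega : n + 1 < n + 2),
        aperyBinom_eq_zero (by omega : n < n + 2), e1, e2]
      generalize aperyCoeff (n + 1) (n + 1) = c
      simp only [show 2 * (n + 2) = 2 * n + 4 by ring,
        show 2 * (n + 1) = 2 * n + 2 by ring, Nat.factorial_succ, Nat.factorial_zero]
      have h1 := n.factorial_ne_zero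
      have h3 := (2 * n).factorial_ne_zero
      rw [pow_succ (-1 : ℚ) n]
      generalize (-1 : ℚ) ^ n = s at *
      push_cast
      field_simp
      ring

/-- The Apéry numbers. -/
def aperyDen (n : ℕ) : ℚ := ∑ k ∈ range (n + 1), aperyBinom n k ^ 2

/-- The numerators of Apéry's approximations to `ζ(3)`. -/
def aperyNum (n : ℕ) : ℚ := ∑ k ∈ range (n + 1), aperyBinom n k ^ 2 * aperyCoeff n k

theorem sum_range_aperyBinom_mul (f : ℕ → ℚ) {n N : ℕ} (h : n < N) :
    ∑ k ∈ range N, aperyBinom n k ^ 2 * f k = ∑ k ∈ range (n + 1), aperyBinom n k ^ 2 * f k := by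
  refine (sum_subset (range_mono h) fun k _ hk => ?_).symm
  rw [aperyBinom_eq_zero (by simpa using hk)]
  ring

theorem aperyDen_recurrence (n : ℕ) : (n + 2 : ℚ) ^ 3 * aperyDen (n + 2) =
    aperyPoly (n + 1) * aperyDen (n + 1) - (n + 1) ^ 3 * aperyDen n := by
  have e (m : ℕ) (hm : m < n + 3) : aperyDen m = ∑ k ∈ range (n + 3), aperyBinom m k ^ 2 := by
    simpa [aperyDen] using (sum_range_aperyBinom_mul (fun _ => 1) hm).symm
  have hs := sum_range_sub (aperyCert (n + 1)) (n + 2)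
  simp only [aperyBinom_telescope, sum_add_distrib, sum_sub_distrib, ← mul_sum] at hs
  rw [e _ (by omega), e (n + 1) (by omega), e n (by omega)]
  simp only [sum_range_succ' _ (n + 2), aperyBinom_zero]
  unfold aperyCert at hs
  rw [aperyBinom_eq_zero (by omega : n + 1 < n + 2), aperyBinom_zero] at hs
  push_cast at hs
  have : aperyPoly (n + 1) = 34 * (n + 1) ^ 3 + 51 * (n + 1) ^ 2 + 27 * (n + 1) + 5 := rfl
  linear_combination hs - this

theorem aperyNum_recurrence (n : ℕ) : (n + 2 : ℚ) ^ 3 * aperyNum (n + 2) =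
    aperyPoly (n + 1) * aperyNum (n + 1) - (n + 1) ^ 3 * aperyNum n := by
  have e (m : ℕ) (hm : m < n + 3) :
      aperyNum m = ∑ k ∈ range (n + 3), aperyBinom m k ^ 2 * aperyCoeff m k :=
    (sum_range_aperyBinom_mul _ hm).symm
  have hs := sum_range_sub (aperyCert' (n + 1)) (n + 2)
  simp only [aperyBinom_mul_aperyCoeff_telescope, sum_add_distrib, sum_sub_distrib,
    ← mul_sum] at hs
  rw [e _ (by omega), e (n + 1) (by omega), e n (by omega)]
  simp only [sum_range_succ' _ (n + 2), aperyBinom_zero]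
  unfold aperyCert' aperyCert at hs
  rw [aperyBinom_eq_zero (by omega : n + 1 < n + 2), aperyBinom_zero] at hs
  have c1 : aperyCoeff (n + 2) 0 = aperyCoeff (n + 1) 0 + 1 / (n + 2) ^ 3 := by
    simp [aperyCoeff, sum_range_succ]
    ring
  have c2 : aperyCoeff (n + 1) 0 = aperyCoeff n 0 + 1 / (n + 1) ^ 3 := by
    simp [aperyCoeff, sum_range_succ]
  have c1' : ((n : ℚ) + 2) ^ 3 * aperyCoeff (n + 2) 0 =
      ((n : ℚ) + 2) ^ 3 * aperyCoeff (n + 1) 0 + 1 := by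
    rw [c1]; field_simp
  have c2' : ((n : ℚ) + 1) ^ 3 * aperyCoeff (n + 1) 0 =
      ((n : ℚ) + 1) ^ 3 * aperyCoeff n 0 + 1 := by
    rw [c2]; field_simp
  push_cast at hs
  have : aperyPoly (n + 1) = 34 * (n + 1) ^ 3 + 51 * (n + 1) ^ 2 + 27 * (n + 1) + 5 := rfl
  linear_combination hs - aperyCoeff (n + 1) 0 * this + c1' - c2'

theorem aperyNum_mul_aperyDen_sub (n : ℕ) :
    aperyNum (n + 1) * aperyDen n - aperyNum n * aperyDen (n + 1) = 6 / (n + 1) ^ 3 := by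
  induction n with
  | zero => norm_num [aperyNum, aperyDen, aperyBinom, aperyCoeff, sum_range_succ]
  | succ n ih =>
    have h1 := aperyDen_recurrence n
    have h2 := aperyNum_recurrence n
    rw [eq_div_iff (by positivity)] at ih ⊢
    push_cast
    linear_combination ih + aperyDen (n + 1) * h2 - aperyNum (n + 1) * h1

theorem aperyDen_pos (n : ℕ) : 0 < aperyDen n := by
  refine lt_of_lt_of_le one_pos ?_
  rw [aperyDen, sum_range_succ', aperyBinom_zero]
  have : 0 ≤ ∑ k ∈ range n, aperyBinom n (k + 1) ^ 2 := sum_nonneg fun _ _ => sq_nonneg _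
  linarith

theorem mul_aperyDen_le (n : ℕ) : 22 * aperyDen (n + 3) ≤ aperyDen (n + 4) := by
  induction n with
  | zero => norm_num [aperyDen, aperyBinom, sum_range_succ, Nat.choose]
  | succ n ih =>
    have h1 := aperyDen_recurrence (n + 3)
    have h2 := aperyDen_pos (n + 4)
    have h3 := aperyDen_pos (n + 3)
    unfold aperyPoly at h1
    push_cast at h1
    have : ((n : ℚ) + 3 + 2) ^ 3 * (22 * aperyDen (n + 4)) ≤
        ((n : ℚ) + 3 + 2) ^ 3 * aperyDen (n + 3 + 2) := by
      rw [h1]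
      have e : ((n : ℚ) + 3 + 1) ^ 3 * aperyDen (n + 3) ≤
        ((n : ℚ) + 3 + 1) ^ 3 * aperyDen (n + 4) := by gcongr; linarith
      have e' : (((n : ℚ) + 3 + 2) ^ 3 * 22 + ((n : ℚ) + 3 + 1) ^ 3) * aperyDen (n + 4) ≤
        (34 * ((n : ℚ) + 3 + 1) ^ 3 + 51 * (n + 3 + 1) ^ 2 + 27 * (n + 3 + 1) + 5) *
          aperyDen (n + 4) := by
        refine mul_le_mul_of_nonneg_right ?_ h2.le
        have : (0 : ℚ) ≤ n := by positivity
        have h2 : (0 : ℚ) ≤ n ^ 2 := by positivity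
        have h3 : (0 : ℚ) ≤ n ^ 3 := by positivity
        nlinarith
      have : aperyDen (n + 3 + 1) = aperyDen (n + 4) := rfl
      rw [this]
      linarith
    exact le_of_mul_le_mul_left this (by positivity)

theorem pow_le_aperyDen (n : ℕ) : (22 : ℚ) ^ n ≤ aperyDen (n + 3) := by
  induction n with
  | zero => norm_num [aperyDen, aperyBinom, sum_range_succ, Nat.choose]
  | succ n ih =>
    have := mul_aperyDen_le n
    rw [pow_succ, show n + 1 + 3 = n + 4 by ring]
    linarith

/-- A consequence of the recurrence for Leibniz's harmonic triangle. -/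
theorem div_mul_choose_mem_range {D n : ℕ} (k : ℕ) (h : ∀ i, 1 ≤ i → i ≤ n → i ∣ D)
    (hk : k < n) : (D : ℚ) / ((k + 1 : ℕ) * n.choose (k + 1) : ℚ) ∈ (Int.castRingHom ℚ).range := by
  induction k generalizing n with
  | zero =>
    obtain ⟨c, hc⟩ := h n hk le_rfl
    refine ⟨c, ?_⟩
    have : (n : ℚ) ≠ 0 := by exact_mod_cast (by omega : n ≠ 0)
    simp [hc]
    field_simp
  | succ k ih =>
    obtain ⟨m, rfl⟩ : ∃ m, n = k + 2 + m := ⟨n - (k + 2), by omega⟩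
    have h1 := ih h (by omega)
    have h2 := ih (n := k + 1 + m) (fun i hi hi' => h i hi (by omega)) (by omega)
    convert sub_mem h2 h1 using 1
    have e1 := Nat.add_one_mul_choose_eq (k + 1 + m) (k + 1)
    have e2 := Nat.add_one_mul_choose_eq (k + 1 + m) k
    have e3 := Nat.choose_succ_succ (k + 1 + m) k
    have p1 : (k + 1 + m).choose k ≠ 0 := (Nat.choose_pos (by omega)).ne'
    have p2 : (k + 1 + m).choose (k + 1) ≠ 0 := (Nat.choose_pos (by omega)).ne'
    have e4 := Nat.choose_succ_right_eq (k + 1 + m) k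
    rw [show k + 1 + m - k = m + 1 by omega] at e4
    rw [show k + 2 + m = k + 1 + m + 1 by ring]
    have q1 : ((k + 1 : ℕ) * (k + 1 + m + 1).choose (k + 1) : ℚ) =
      (k + 1 + m + 1) * (k + 1 + m).choose k := by exact_mod_cast (by linarith)
    have q2 : ((k + 1 + 1 : ℕ) * (k + 1 + m + 1).choose (k + 1 + 1) : ℚ) =
      (k + 1 + m + 1) * (k + 1 + m).choose (k + 1) := by exact_mod_cast (by linarith)
    have q4 : ((k + 1 + m).choose (k + 1) : ℚ) =
      (k + 1 + m).choose k * (m + 1) / (k + 1) := by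
      rw [eq_div_iff (by positivity)]; exact_mod_cast e4
    rw [q1, q2, q4]
    have p1' : ((k + 1 + m).choose k : ℚ) ≠ 0 := by exact_mod_cast p1
    push_cast
    field_simp
    ring

theorem natCast_mem_range (n : ℕ) : (n : ℚ) ∈ (Int.castRingHom ℚ).range := ⟨n, by simp⟩

theorem div_mem_range_of_dvd {a b : ℕ} (h : b ∣ a) : (a : ℚ) / b ∈ (Int.castRingHom ℚ).range := by
  obtain ⟨c, rfl⟩ := h
  rcases eq_or_ne b 0 with rfl | hb
  · simp
  · refine ⟨c, ?_⟩
    have : (b : ℚ) ≠ 0 := by exact_mod_cast hb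
    simp
    field_simp

theorem dvd_lcmUpto {i n : ℕ} (h1 : 1 ≤ i) (h2 : i ≤ n) : i ∣ Nat.lcmUpto n :=
  Finset.dvd_lcm (f := id) (by simp [h1, h2])

theorem aperyBinom_sq_mul_aperyCoeff_mem_range {n k : ℕ} (hk : k ≤ n) :
    2 * (Nat.lcmUpto n : ℚ) ^ 3 * (aperyBinom n k ^ 2 * aperyCoeff n k) ∈
      (Int.castRingHom ℚ).range := by
  set d := Nat.lcmUpto n
  have hB : aperyBinom n k ∈ (Int.castRingHom ℚ).range :=
    mul_mem (natCast_mem_range _) (natCast_mem_range _)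
  have h2 : (2 : ℚ) ∈ (Int.castRingHom ℚ).range := by exact_mod_cast natCast_mem_range 2
  rw [aperyCoeff, mul_add, mul_add, mul_sum, mul_sum, mul_sum, mul_sum]
  refine add_mem (sum_mem fun m hm => ?_) (sum_mem fun m hm => ?_)
  · have hm := mem_range.1 hm
    have := div_mem_range_of_dvd (dvd_lcmUpto (i := m + 1) (n := n) (by omega) (by omega))
    convert mul_mem (mul_mem h2 (pow_mem hB 2)) (pow_mem this 3) using 1
    push_cast
    field_simp
    simp only [d, mul_comm]
  · have hm := mem_range.1 hm
    have i1 := div_mem_range_of_dvd (dvd_lcmUpto (i := m + 1) (n := n) (by omega) (by omega))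
    have i2 := div_mul_choose_mem_range (n := n) m (fun i h1 h2 => dvd_lcmUpto h1 h2) (by omega)
    have i3 := div_mul_choose_mem_range (n := k) (D := d) m
      (fun i h1 h2 => dvd_lcmUpto h1 (h2.trans hk)) hm
    obtain ⟨l, rfl⟩ : ∃ l, k = m + 1 + l := ⟨k - (m + 1), by omega⟩
    have e : ((n + (m + 1 + l)).choose (m + 1 + l) : ℚ) * (m + 1 + l).choose (m + 1) =
        (n + (m + 1 + l)).choose l * (n + (m + 1)).choose (m + 1) := by
      have := Nat.choose_mul (n := n + (m + 1 + l)) (k := m + 1 + l) (s := l) (by omega)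
      rw [Nat.choose_symm_of_eq_add (rfl : m + 1 + l = m + 1 + l)]
      rw [show n + (m + 1 + l) - l = n + (m + 1) by omega,
        show m + 1 + l - l = m + 1 by omega] at this
      exact_mod_cast this
    convert mul_mem (mul_mem (mul_mem i1 (mul_mem i2 i3)) (mul_mem
      (mul_mem (pow_mem (natCast_mem_range (n.choose (m + 1 + l))) 2)
        (natCast_mem_range ((n + (m + 1 + l)).choose (m + 1 + l))))
      (natCast_mem_range ((n + (m + 1 + l)).choose l))))
      (pow_mem (neg_mem (one_mem _)) m) using 1
    have p1 : (n.choose (m + 1) : ℚ) ≠ 0 := by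
      exact_mod_cast (Nat.choose_pos (by omega : m + 1 ≤ n)).ne'
    have p2 : ((m + 1 + l).choose (m + 1) : ℚ) ≠ 0 := by
      exact_mod_cast (Nat.choose_pos (by omega : m + 1 ≤ m + 1 + l)).ne'
    have p3 : ((n + (m + 1)).choose (m + 1) : ℚ) ≠ 0 := by
      exact_mod_cast (Nat.choose_pos (by omega : m + 1 ≤ n + (m + 1))).ne'
    unfold aperyBinom
    push_cast
    field_simp
    linear_combination (d : ℚ) ^ 3 * (n.choose (m + 1 + l)) ^ 2 * ((n + (m + 1 + l)).choose (m + 1 + l) : ℚ) * e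

theorem aperyNum_mem_range (n : ℕ) :
    2 * (Nat.lcmUpto n : ℚ) ^ 3 * aperyNum n ∈ (Int.castRingHom ℚ).range := by
  rw [aperyNum, mul_sum]
  exact sum_mem fun k hk => aperyBinom_sq_mul_aperyCoeff_mem_range
    (Nat.lt_succ_iff.1 (mem_range.1 hk))

theorem aperyDen_mem_range (n : ℕ) : aperyDen n ∈ (Int.castRingHom ℚ).range :=
  sum_mem fun _ _ => pow_mem (mul_mem (natCast_mem_range _) (natCast_mem_range _)) 2

end

section

open Finset Filter Topology

theorem zetaR_summable {s : ℕ} (hs : 2 ≤ s) : Summable fun n : ℕ => 1 / (n + 1 : ℝ) ^ s := by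
  have := (summable_nat_add_iff 1).2 (Real.summable_one_div_nat_pow.2 (by omega : 1 < s))
  simpa using this

theorem natCast_le_aperyBinom {n k : ℕ} (hk : k < n) : (n : ℝ) ≤ aperyBinom n (k + 1) := by
  have h1 : 1 ≤ n.choose (k + 1) := Nat.choose_pos hk
  have h2 : n ≤ (n + (k + 1)).choose (k + 1) := by
    rw [← Nat.choose_symm_add]
    calc n ≤ (n + 1).choose n := by simp
      _ ≤ _ := Nat.choose_le_choose _ (by omega)
  unfold aperyBinom
  push_cast
  have : n ≤ n.choose (k + 1) * (n + (k + 1)).choose (k + 1) := by nlinarith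
  exact_mod_cast this

theorem abs_aperyCoeff_sub_le {n k : ℕ} (hk : k ≤ n) (hn : 0 < n) :
    |(aperyCoeff n k : ℝ) - ∑ m ∈ range n, 1 / (m + 1 : ℝ) ^ 3| ≤ zetaR 3 / n := by
  have e : (aperyCoeff n k : ℝ) - ∑ m ∈ range n, 1 / (m + 1 : ℝ) ^ 3 =
      ∑ m ∈ range k, (-1) ^ m / (2 * ((m : ℝ) + 1) ^ 3 * aperyBinom n (m + 1)) := by
    simp [aperyCoeff]
  have hn' : (0 : ℝ) < n := by exact_mod_cast hn
  rw [e]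
  calc _ ≤ ∑ m ∈ range k, |(-1) ^ m / (2 * ((m : ℝ) + 1) ^ 3 * aperyBinom n (m + 1))| :=
        abs_sum_le_sum_abs _ _
    _ ≤ ∑ m ∈ range k, 1 / (m + 1 : ℝ) ^ 3 / n := by
        refine sum_le_sum fun m hm => ?_
        have hb := natCast_le_aperyBinom (n := n) (k := m) (by have := mem_range.1 hm; omega)
        have hb0 : (0 : ℝ) < aperyBinom n (m + 1) := hn'.trans_le hb
        rw [abs_div, abs_pow, abs_neg, abs_one, one_pow, abs_of_pos (by positivity), div_div]
        gcongr
        linarith [show (0 : ℝ) < (m + 1 : ℝ) ^ 3 by positivity]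
    _ = (∑ m ∈ range k, 1 / (m + 1 : ℝ) ^ 3) / n := by rw [sum_div]
    _ ≤ _ := by
        gcongr
        exact (zetaR_summable (by norm_num)).sum_le_tsum _ fun m _ => by positivity

theorem tendsto_aperyNum_div_aperyDen :
    Tendsto (fun n => (aperyNum n : ℝ) / aperyDen n) atTop (𝓝 (zetaR 3)) := by
  have h1 : Tendsto (fun n => ∑ m ∈ range n, 1 / (m + 1 : ℝ) ^ 3) atTop (𝓝 (zetaR 3)) :=
    (zetaR_summable (by norm_num)).hasSum.tendsto_sum_nat
  have h2 : Tendsto (fun n : ℕ => zetaR 3 / n) atTop (𝓝 0) :=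
    tendsto_const_div_atTop_nhds_zero_nat _
  have h3 : Tendsto (fun n => (aperyNum n : ℝ) / aperyDen n - ∑ m ∈ range n, 1 / (m + 1 : ℝ) ^ 3)
      atTop (𝓝 0) := by
    refine squeeze_zero_norm' ?_ h2
    filter_upwards [eventually_gt_atTop 0] with n hn
    have hp : (0 : ℝ) < aperyDen n := by exact_mod_cast aperyDen_pos n
    have e : (aperyNum n : ℝ) / aperyDen n - ∑ m ∈ range n, 1 / (m + 1 : ℝ) ^ 3 =
        (∑ k ∈ range (n + 1), (aperyBinom n k : ℝ) ^ 2 *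
          ((aperyCoeff n k : ℝ) - ∑ m ∈ range n, 1 / (m + 1 : ℝ) ^ 3)) / aperyDen n := by
      simp_rw [mul_sub, sum_sub_distrib, ← sum_mul]
      rw [sub_div, aperyNum, eq_comm]
      congr 1
      · push_cast
        rfl
      · rw [div_eq_iff hp.ne', mul_comm, aperyDen]
        push_cast
        rfl
    rw [e, Real.norm_eq_abs, abs_div, abs_of_pos hp, div_le_iff₀ hp]
    calc _ ≤ ∑ k ∈ range (n + 1), |(aperyBinom n k : ℝ) ^ 2 *
          ((aperyCoeff n k : ℝ) - ∑ m ∈ range n, 1 / (m + 1 : ℝ) ^ 3)| := abs_sum_le_sum_abs _ _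
      _ ≤ ∑ k ∈ range (n + 1), (aperyBinom n k : ℝ) ^ 2 * (zetaR 3 / n) := by
        refine sum_le_sum fun k hk => ?_
        rw [abs_mul, abs_of_nonneg (sq_nonneg _)]
        gcongr
        exact abs_aperyCoeff_sub_le (Nat.lt_succ_iff.1 (mem_range.1 hk)) hn
      _ = _ := by
        rw [← sum_mul, mul_comm, aperyDen]
        push_cast
        rfl
  simpa using h3.add h1

theorem aperyNum_div_succ (n : ℕ) : (aperyNum (n + 1) : ℝ) / aperyDen (n + 1) =
    aperyNum n / aperyDen n + 6 / (((n : ℝ) + 1) ^ 3 * (aperyDen n * aperyDen (n + 1))) := by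
  have h1 : (0 : ℝ) < aperyDen n := by exact_mod_cast aperyDen_pos n
  have h2 : (0 : ℝ) < aperyDen (n + 1) := by exact_mod_cast aperyDen_pos (n + 1)
  have h := aperyNum_mul_aperyDen_sub n
  rw [eq_div_iff (by positivity)] at h
  have h' : ((aperyNum (n + 1) : ℝ) * aperyDen n - aperyNum n * aperyDen (n + 1)) *
    ((n : ℝ) + 1) ^ 3 = 6 := by exact_mod_cast h
  rw [← h']
  field_simp
  ring

theorem aperyNum_lt (n : ℕ) : (aperyNum n : ℝ) / aperyDen n < zetaR 3 := by
  have hm : StrictMono fun n => (aperyNum n : ℝ) / aperyDen n := by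
    refine strictMono_nat_of_lt_succ fun n => ?_
    rw [aperyNum_div_succ]
    have h1 : (0 : ℝ) < aperyDen n := by exact_mod_cast aperyDen_pos n
    have h2 : (0 : ℝ) < aperyDen (n + 1) := by exact_mod_cast aperyDen_pos (n + 1)
    have : 0 < 6 / (((n : ℝ) + 1) ^ 3 * (aperyDen n * aperyDen (n + 1))) := by positivity
    linarith
  exact (hm n.lt_succ_self).trans_le (hm.monotone.ge_of_tendsto tendsto_aperyNum_div_aperyDen _)

theorem zetaR_three_le (n : ℕ) :
    zetaR 3 ≤ (aperyNum (n + 3) : ℝ) / aperyDen (n + 3) + 1 / (aperyDen (n + 3) : ℝ) ^ 2 := by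
  have hm : Antitone fun n => (aperyNum (n + 3) : ℝ) / aperyDen (n + 3) +
      1 / (aperyDen (n + 3) : ℝ) ^ 2 := by
    refine antitone_nat_of_succ_le fun n => ?_
    rw [show n + 1 + 3 = n + 3 + 1 by ring, aperyNum_div_succ]
    have h1 : (0 : ℝ) < aperyDen (n + 3) := by exact_mod_cast aperyDen_pos (n + 3)
    have h3 : 22 * (aperyDen (n + 3) : ℝ) ≤ aperyDen (n + 3 + 1) := by
      exact_mod_cast mul_aperyDen_le n
    set x : ℝ := ((aperyDen (n + 3) : ℚ) : ℝ)
    have e1 : 6 / (((n + 3 : ℕ) + 1 : ℝ) ^ 3 * (x * aperyDen (n + 3 + 1))) ≤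
        6 / (1 * (x * (22 * x))) := by
      gcongr
      exact one_le_pow₀ (by linarith [(Nat.cast_nonneg (n + 3) : (0 : ℝ) ≤ (n + 3 : ℕ))])
    have e2 : 1 / (aperyDen (n + 3 + 1) : ℝ) ^ 2 ≤ 1 / (22 * x) ^ 2 := by gcongr
    have e3 : 6 / (1 * (x * (22 * x))) + 1 / (22 * x) ^ 2 ≤ 1 / x ^ 2 := by
      rw [div_add_div _ _ (by positivity) (by positivity), div_le_div_iff₀ (by positivity)
        (by positivity)]
      have : 0 < x ^ 6 := by positivity
      nlinarith
    linarith
  refine le_of_tendsto_of_tendsto tendsto_aperyNum_div_aperyDen tendsto_const_nhds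
    (eventually_atTop.2 ⟨n + 3, fun m hm' => ?_⟩)
  obtain ⟨k, rfl⟩ : ∃ k, m = k + 3 := ⟨m - 3, by omega⟩
  have h := hm (show n ≤ k by omega)
  have : 0 ≤ 1 / (aperyDen (k + 3) : ℝ) ^ 2 := by positivity
  simp only at h
  linarith

/-- The theorem of Apéry. -/
theorem irrational_zetaR_three : Irrational (zetaR 3) := by
  rintro ⟨r, hr⟩
  have h28 : Real.exp 1 < 2.8 := Real.exp_one_lt_d9.trans (by norm_num)
  have hlim : Tendsto (fun n : ℕ => 2 * r.den * 22 ^ 3 * ((21.952 / 22 : ℝ) ^ n)) atTop (𝓝 0) := by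
    have := (tendsto_pow_atTop_nhds_zero_of_lt_one (by norm_num : (0 : ℝ) ≤ 21.952 / 22)
      (by norm_num)).const_mul (2 * r.den * 22 ^ 3 : ℝ)
    simpa using this
  obtain ⟨n, hn1, hn2, hn3⟩ := ((eventually_lcmUpto_le_pow h28).and
    ((hlim.eventually (gt_mem_nhds one_pos)).and (eventually_ge_atTop 3))).exists
  obtain ⟨k, rfl⟩ : ∃ k, n = k + 3 := ⟨n - 3, by omega⟩
  set n := k + 3
  set d := Nat.lcmUpto n
  have ha : (0 : ℝ) < aperyDen n := by exact_mod_cast aperyDen_pos n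
  have ha' : (22 : ℝ) ^ n ≤ 22 ^ 3 * aperyDen n := by
    have : (22 : ℝ) ^ k ≤ aperyDen n := by exact_mod_cast pow_le_aperyDen k
    rw [show n = k + 3 from rfl, pow_add, mul_comm]
    gcongr
  have hd : (0 : ℝ) < d := by exact_mod_cast Nat.pos_of_ne_zero (Nat.lcmUpto_ne_zero n)
  have hq : (0 : ℝ) < r.den := by exact_mod_cast r.pos
  obtain ⟨u, hu⟩ := aperyNum_mem_range n
  obtain ⟨v, hv⟩ := aperyDen_mem_range n
  have hu' : (u : ℝ) = 2 * (d : ℝ) ^ 3 * aperyNum n := by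
    have : (u : ℚ) = 2 * (d : ℚ) ^ 3 * aperyNum n := hu
    exact_mod_cast this
  have hv' : (v : ℝ) = aperyDen n := by
    have : (v : ℚ) = aperyDen n := hv
    exact_mod_cast this
  have hr' : zetaR 3 * r.den = r.num := by
    rw [← hr]; exact_mod_cast Rat.mul_den_eq_num r
  have key : ((2 * d ^ 3 * v * r.num - r.den * u : ℤ) : ℝ) =
      2 * r.den * d ^ 3 * (aperyDen n * (zetaR 3 - aperyNum n / aperyDen n)) := by
    push_cast
    rw [hu', hv', ← hr']
    field_simp
  have p1 : 0 < zetaR 3 - aperyNum n / aperyDen n := sub_pos.2 (aperyNum_lt n)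
  have p2 : zetaR 3 - aperyNum n / aperyDen n ≤ 1 / (aperyDen n : ℝ) ^ 2 := by
    linarith [zetaR_three_le k]
  have l1 : (0 : ℝ) < (2 * d ^ 3 * v * r.num - r.den * u : ℤ) := by
    rw [key]; positivity
  have l2 : ((2 * d ^ 3 * v * r.num - r.den * u : ℤ) : ℝ) < 1 := by
    rw [key]
    calc _ ≤ 2 * r.den * (2.8 ^ n) ^ 3 * (aperyDen n * (1 / (aperyDen n : ℝ) ^ 2)) := by
          gcongr
      _ = 2 * r.den * 21.952 ^ n * (1 / aperyDen n) := by
          rw [← pow_mul, mul_comm n 3, pow_mul]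
          field_simp
          norm_num
      _ ≤ 2 * r.den * 21.952 ^ n * (22 ^ 3 / 22 ^ n) := by
          gcongr 2 * r.den * 21.952 ^ n * ?_
          rw [div_le_div_iff₀ ha (by positivity)]
          linarith
      _ = _ := by rw [div_pow]; ring
      _ < 1 := hn2
  have l1' : 0 < 2 * d ^ 3 * v * r.num - r.den * u := by exact_mod_cast l1
  have l2' : 2 * d ^ 3 * v * r.num - r.den * u < 1 := by exact_mod_cast l2
  omega

end

section

open Filter Topology

theorem eventually_eq_zero_of_tendsto_intCast {u : ℕ → ℤ}
    (h : Tendsto (fun n => (u n : ℝ)) atTop (𝓝 0)) : ∀ᶠ n in atTop, u n = 0 := by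
  filter_upwards [h.eventually (Metric.ball_mem_nhds 0 one_pos)] with n hn
  rw [dist_zero_right, Real.norm_eq_abs] at hn
  exact Int.abs_lt_one_iff.1 (by exact_mod_cast hn)

/-- A two-dimensional linear independence criterion: the linear forms `u n + v n * ξ` cannot tend
to zero with consecutive determinants, all divisible by `D n`, being smaller than `D n`. -/
theorem false_of_small_linear_forms {ξ : ℝ} {u v D : ℕ → ℤ}
    (hne : ∀ᶠ n in atTop, (u n : ℝ) + v n * ξ ≠ 0)
    (hlim : Tendsto (fun n => (u n : ℝ) + v n * ξ) atTop (𝓝 0))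
    (hD : ∀ n, D n ∣ v n) (hD' : ∀ n, D n ∣ v (n + 1))
    (hsmall : ∀ᶠ n in atTop, |(u n + v n * ξ) * v (n + 1)| +
      |(u (n + 1) + v (n + 1) * ξ) * v n| < D n) : False := by
  obtain ⟨N, hN⟩ := eventually_atTop.1 (hne.and hsmall)
  set L : ℕ → ℝ := fun n => u n + v n * ξ with hL
  have hdet (n : ℕ) (hn : N ≤ n) : u n * v (n + 1) - u (n + 1) * v n = 0 := by
    refine Int.eq_zero_of_abs_lt_dvd (m := D n)
      (dvd_sub ((hD' n).mul_left _) ((hD n).mul_left _)) ?_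
    have e : ((u n * v (n + 1) - u (n + 1) * v n : ℤ) : ℝ) =
        (u n + v n * ξ) * v (n + 1) - (u (n + 1) + v (n + 1) * ξ) * v n := by
      push_cast; ring
    have : ((|u n * v (n + 1) - u (n + 1) * v n| : ℤ) : ℝ) < D n := by
      rw [Int.cast_abs, e]
      exact (abs_sub _ _).trans_lt (hN n hn).2
    exact_mod_cast this
  have hdet' (n : ℕ) (hn : N ≤ n) : (u n * v (n + 1) - u (n + 1) * v n : ℝ) = 0 := by
    exact_mod_cast hdet n hn
  have hconst (w : ℕ → ℤ) (hw : ∀ n, N ≤ n → w n * L (n + 1) = w (n + 1) * L n) :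
      ∀ᶠ n in atTop, w n = 0 := by
    have hc (n : ℕ) (hn : N ≤ n) : (w n : ℝ) = w N / L N * L n := by
      induction n, hn using Nat.le_induction with
      | base => exact (div_mul_cancel₀ _ (hN N le_rfl).1).symm
      | succ n hn ih =>
        have h1 := hw n hn
        have h2 := (hN n hn).1
        refine mul_right_cancel₀ h2 ?_
        rw [← h1, ih]
        ring
    refine eventually_eq_zero_of_tendsto_intCast ?_
    have : Tendsto (fun n => w N / L N * L n) atTop (𝓝 0) := by simpa using hlim.const_mul _
    refine this.congr' ?_
    filter_upwards [eventually_ge_atTop N] with n hn using (hc n hn).symm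
  have hu := hconst u fun n hn => by
    simp only [hL]
    linear_combination ξ * hdet' n hn
  have hv := hconst v fun n hn => by
    simp only [hL]
    linear_combination -hdet' n hn
  obtain ⟨n, h1, h2, h3⟩ := (hu.and (hv.and hne)).exists
  simp [h1, h2] at h3

end

section

open Finset

/-- `IntegralPartialFraction n b F M` says that `F` has a partial fraction decomposition with
poles of order at most `b` at `0, -1, …, -n`, whose coefficients have denominators controlled by
powers of `lcm(1, …, n)`, and absolute values adding up to at most `M`. -/
def IntegralPartialFraction (n b : ℕ) (F : ℚ → ℚ) (M : ℚ) : Prop :=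
  ∃ c : ℕ → ℕ → ℚ,
    (∀ t : ℚ, (∀ s ∈ range (n + 1), t + s ≠ 0) →
      F t = ∑ i ∈ range b, ∑ j ∈ range (n + 1), c i j / (t + j) ^ (i + 1)) ∧
    (∀ i ∈ range b, ∀ j ∈ range (n + 1),
      (Nat.lcmUpto n : ℚ) ^ (b - 1 - i) * c i j ∈ (Int.castRingHom ℚ).range) ∧
    ∑ i ∈ range b, ∑ j ∈ range (n + 1), |c i j| ≤ M

namespace IntegralPartialFraction

variable {n b : ℕ} {F G : ℚ → ℚ} {M M' : ℚ}

theorem congr (h : IntegralPartialFraction n b F M)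
    (hFG : ∀ t : ℚ, (∀ s ∈ range (n + 1), t + s ≠ 0) → G t = F t) (hM : M ≤ M') :
    IntegralPartialFraction n b G M' := by
  obtain ⟨c, h1, h2, h3⟩ := h
  exact ⟨c, fun t ht => (hFG t ht).trans (h1 t ht), h2, h3.trans hM⟩

theorem zero : IntegralPartialFraction n b (fun _ => 0) 0 :=
  ⟨fun _ _ => 0, by simp, by simp, by simp⟩

theorem add (hF : IntegralPartialFraction n b F M) (hG : IntegralPartialFraction n b G M') :
    IntegralPartialFraction n b (fun t => F t + G t) (M + M') := by
  obtain ⟨c, h1, h2, h3⟩ := hF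
  obtain ⟨c', h1', h2', h3'⟩ := hG
  refine ⟨fun i j => c i j + c' i j, fun t ht => ?_, fun i hi j hj => ?_, ?_⟩
  · simp only [h1 t ht, h1' t ht, add_div, sum_add_distrib]
  · rw [mul_add]
    exact add_mem (h2 i hi j hj) (h2' i hi j hj)
  · refine le_trans ?_ (add_le_add h3 h3')
    rw [← sum_add_distrib]
    refine sum_le_sum fun i _ => ?_
    rw [← sum_add_distrib]
    exact sum_le_sum fun j _ => abs_add_le _ _

theorem neg (hF : IntegralPartialFraction n b F M) :
    IntegralPartialFraction n b (fun t => -F t) M := by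
  obtain ⟨c, h1, h2, h3⟩ := hF
  refine ⟨fun i j => -c i j, fun t ht => ?_, fun i hi j hj => ?_, by simpa using h3⟩
  · simp only [h1 t ht, neg_div, sum_neg_distrib]
  · rw [mul_neg]
    exact neg_mem (h2 i hi j hj)

theorem sum {ι : Type*} (S : Finset ι) {F : ι → ℚ → ℚ} {M : ι → ℚ}
    (h : ∀ x ∈ S, IntegralPartialFraction n b (F x) (M x)) :
    IntegralPartialFraction n b (fun t => ∑ x ∈ S, F x t) (∑ x ∈ S, M x) := by
  classical
  induction S using Finset.induction_on with
  | empty => simpa using zero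
  | insert a S ha ih =>
    simp only [sum_insert ha]
    exact (h a (mem_insert_self a S)).add (ih fun x hx => h x (mem_insert_of_mem hx))

theorem div_pow {i j : ℕ} (hi : i < b) (hj : j ∈ range (n + 1)) {x : ℚ}
    (hx : (Nat.lcmUpto n : ℚ) ^ (b - 1 - i) * x ∈ (Int.castRingHom ℚ).range) :
    IntegralPartialFraction n b (fun t => x / (t + j) ^ (i + 1)) |x| := by
  refine ⟨fun i' j' => if i' = i then if j' = j then x else 0 else 0, fun t _ => ?_,
    fun i' _ j' _ => ?_, ?_⟩
  · rw [sum_eq_single_of_mem i (mem_range.2 hi), sum_eq_single_of_mem j hj]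
    · simp
    · intro j' _ h; simp [h]
    · intro i' _ h; simp [h]
  · by_cases h : i' = i
    · by_cases h' : j' = j
      · simpa [h, h'] using hx
      · simp [h']
    · simp [h]
  · rw [sum_eq_single_of_mem i (mem_range.2 hi), sum_eq_single_of_mem j hj]
    · simp
    · intro j' _ h; simp [h]
    · intro i' _ h; simp [h]

theorem natAbs_sub_dvd_lcmUpto {j s : ℕ} (hj : j ∈ range (n + 1)) (hs : s ∈ range (n + 1))
    (h : s ≠ j) : (Nat.lcmUpto n : ℚ) / ((s : ℚ) - j) ∈ (Int.castRingHom ℚ).range := by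
  have hj := mem_range.1 hj
  have hs := mem_range.1 hs
  rcases lt_or_gt_of_ne h with h | h
  · have := div_mem_range_of_dvd (dvd_lcmUpto (i := j - s) (n := n) (by omega) (by omega))
    rw [Nat.cast_sub h.le] at this
    rw [← neg_sub, div_neg]
    exact neg_mem this
  · have := div_mem_range_of_dvd (dvd_lcmUpto (i := s - j) (n := n) (by omega) (by omega))
    rwa [Nat.cast_sub h.le] at this

theorem div_pow_mul {p j s : ℕ} (hp : p ≤ b) (hj : j ∈ range (n + 1)) (hs : s ∈ range (n + 1))
    {x : ℚ} (hx : (Nat.lcmUpto n : ℚ) ^ (b - p) * x ∈ (Int.castRingHom ℚ).range) :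
    IntegralPartialFraction n (b + 1) (fun t => x / ((t + j) ^ p * (t + s))) ((p + 1) * |x|) := by
  rcases eq_or_ne s j with rfl | hsj
  · refine (div_pow (i := p) (by omega) hj (x := x) (by simpa using hx)).congr
      (fun t ht => by rw [pow_succ]) ?_
    nlinarith [abs_nonneg x, (Nat.cast_nonneg p : (0 : ℚ) ≤ p)]
  have hne : (s : ℚ) - j ≠ 0 := sub_ne_zero.2 (by exact_mod_cast hsj)
  have habs : 1 ≤ |(s : ℚ) - j| := by
    have : (1 : ℤ) ≤ |(s : ℤ) - j| := Int.one_le_abs (by omega)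
    exact_mod_cast this
  induction p generalizing x with
  | zero =>
    refine (div_pow (i := 0) (by omega) hs (x := x) (by simpa using hx)).congr
      (fun t ht => by simp) (by simp)
  | succ p ih =>
    have hx' : (Nat.lcmUpto n : ℚ) ^ (b - p) * (x / (s - j)) ∈ (Int.castRingHom ℚ).range := by
      convert mul_mem hx (natAbs_sub_dvd_lcmUpto hj hs hsj) using 1
      rw [show b - p = b - (p + 1) + 1 by omega, pow_succ]
      ring
    have h1 := ih (by omega) hx'
    have h2 := div_pow (b := b + 1) (i := p) (by omega) hj (x := x / (s - j)) (by simpa using hx')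
    refine (h2.add h1.neg).congr (fun t ht => ?_) ?_
    · have h3 := ht j hj
      have h4 := ht s hs
      field_simp
      ring
    · have : |x / ((s : ℚ) - j)| ≤ |x| := by
        rw [abs_div]
        exact div_le_self (abs_nonneg x) habs
      push_cast
      nlinarith [abs_nonneg x, (Nat.cast_nonneg p : (0 : ℚ) ≤ p)]

theorem mul_sum_div (hF : IntegralPartialFraction n b F M) (e : ℕ → ℤ) :
    IntegralPartialFraction n (b + 1) (fun t => F t * ∑ s ∈ range (n + 1), (e s : ℚ) / (t + s))
      ((b + 1) * M * ∑ s ∈ range (n + 1), |(e s : ℚ)|) := by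
  obtain ⟨c, h1, h2, h3⟩ := hF
  have key : IntegralPartialFraction n (b + 1)
      (fun t => ∑ i ∈ range b, ∑ j ∈ range (n + 1), ∑ s ∈ range (n + 1),
        c i j * e s / ((t + j) ^ (i + 1) * (t + s)))
      (∑ i ∈ range b, ∑ j ∈ range (n + 1), ∑ s ∈ range (n + 1),
        (((i + 1 : ℕ) : ℚ) + 1) * |c i j * e s|) := by
    refine sum _ fun i hi => sum _ fun j hj => sum _ fun s hs => ?_
    have hi' := mem_range.1 hi
    refine div_pow_mul (by omega) hj hs ?_
    rw [← mul_assoc]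
    refine mul_mem ?_ ⟨e s, by simp⟩
    rw [show b - (i + 1) = b - 1 - i by omega]
    exact h2 i hi j hj
  refine key.congr (fun t ht => ?_) ?_
  · rw [h1 t ht, sum_mul]
    refine sum_congr rfl fun i _ => ?_
    rw [sum_mul]
    refine sum_congr rfl fun j _ => ?_
    rw [mul_sum]
    exact sum_congr rfl fun s _ => by rw [div_mul_div_comm]
  · calc _ ≤ ∑ i ∈ range b, ∑ j ∈ range (n + 1), ∑ s ∈ range (n + 1),
        ((b : ℚ) + 1) * |c i j * e s| := by
          gcongr with i hi
          exact mem_range.1 hi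
      _ = (b + 1) * (∑ i ∈ range b, ∑ j ∈ range (n + 1), |c i j|) *
          ∑ s ∈ range (n + 1), |(e s : ℚ)| := by
          simp_rw [abs_mul, ← mul_sum, ← sum_mul, mul_assoc]
      _ ≤ _ := by gcongr

theorem one_pole (e : ℕ → ℤ) :
    IntegralPartialFraction n 1 (fun t => ∑ s ∈ range (n + 1), (e s : ℚ) / (t + s))
      (∑ s ∈ range (n + 1), |(e s : ℚ)|) :=
  (sum _ fun s hs => div_pow (i := 0) zero_lt_one hs (x := (e s : ℚ)) ⟨e s, by simp⟩).congr
    (fun t _ => by simp) le_rfl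

theorem mul_prod {K : ℚ} {r : ℕ} (hF : IntegralPartialFraction n b F M) (hM : 0 ≤ M)
    (e : ℕ → ℕ → ℤ) (hK : (b + r : ℚ) ≤ K) :
    IntegralPartialFraction n (b + r)
      (fun t => F t * ∏ i ∈ range r, ∑ s ∈ range (n + 1), (e i s : ℚ) / (t + s))
      (K ^ r * M * ∏ i ∈ range r, ∑ s ∈ range (n + 1), |(e i s : ℚ)|) := by
  induction r with
  | zero => simpa using hF
  | succ r ih =>
    push_cast at hK
    have hK0 : (0 : ℚ) ≤ K := by linarith [(Nat.cast_nonneg (b + r) : (0 : ℚ) ≤ (b + r : ℕ)),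
      (Nat.cast_add b r : ((b + r : ℕ) : ℚ) = b + r)]
    have hp : 0 ≤ ∏ i ∈ range r, ∑ s ∈ range (n + 1), |(e i s : ℚ)| :=
      prod_nonneg fun i _ => sum_nonneg fun s _ => abs_nonneg _
    refine ((ih (by linarith)).mul_sum_div (e r)).congr (fun t _ => ?_) ?_
    · rw [prod_range_succ, mul_assoc]
    · rw [prod_range_succ]
      have hs : 0 ≤ ∑ s ∈ range (n + 1), |(e r s : ℚ)| := sum_nonneg fun s _ => abs_nonneg _
      generalize ∏ i ∈ range r, ∑ s ∈ range (n + 1), |(e i s : ℚ)| = P at *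
      have hk : ((b + r : ℕ) : ℚ) + 1 ≤ K := by
        push_cast
        linarith
      calc _ ≤ K * (K ^ r * M * P) * ∑ s ∈ range (n + 1), |(e r s : ℚ)| :=
            mul_le_mul_of_nonneg_right
              (mul_le_mul_of_nonneg_right hk (mul_nonneg (mul_nonneg (pow_nonneg hK0 _) hM) hp)) hs
        _ = _ := by rw [pow_succ]; ring

end IntegralPartialFraction

theorem prod_erase_natCast_sub {n s : ℕ} (hs : s ≤ n) :
    ∏ j ∈ (range (n + 1)).erase s, ((j : ℚ) - s) = (-1) ^ s * s.factorial * (n - s).factorial := by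
  induction n, hs using Nat.le_induction with
  | base =>
    rw [range_add_one, erase_insert (by simp)]
    rw [← prod_range_reflect]
    have : ∀ j ∈ range s, (((s - 1 - j : ℕ) : ℚ) - s) = (-1) * ((j + 1 : ℕ) : ℚ) := by
      intro j hj
      have := mem_range.1 hj
      have e : s = (s - 1 - j) + (j + 1) := by omega
      have : (s : ℚ) = (s - 1 - j : ℕ) + (j + 1 : ℕ) := by exact_mod_cast e
      rw [this]
      ring
    rw [prod_congr rfl this, prod_mul_distrib, ← Nat.cast_prod, prod_range_add_one_eq_factorial]
    simp
  | succ n hn ih =>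
    rw [range_add_one, erase_insert_of_ne (by omega), prod_insert (by simp), ih,
      show n + 1 - s = n - s + 1 by omega, Nat.factorial_succ, ← Nat.cast_sub (by omega),
      show n + 1 - s = n - s + 1 by omega]
    push_cast
    ring

/-- Lagrange interpolation at `0, -1, …, -n` of a split polynomial of degree at most `n`. -/
theorem prod_add_div_prod_add (n : ℕ) {κ : ℕ} (hκ : κ ≤ n) (y : ℕ → ℚ) {t : ℚ}
    (ht : ∀ s ∈ range (n + 1), t + s ≠ 0) :
    (∏ m ∈ range κ, (t + y m)) / ∏ s ∈ range (n + 1), (t + s) =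
      ∑ s ∈ range (n + 1), (∏ m ∈ range κ, (-s + y m)) /
        ((-1) ^ s * s.factorial * (n - s).factorial) / (t + s) := by
  set P : Polynomial ℚ := ∏ m ∈ range κ, (Polynomial.X + Polynomial.C (y m)) with hP
  have hdeg : P.degree < (range (n + 1)).card := by
    refine lt_of_le_of_lt (Polynomial.degree_prod_le _ _) ?_
    simp only [Polynomial.degree_X_add_C, sum_const, card_range]
    rw [nsmul_one]
    exact_mod_cast Nat.lt_succ_of_le hκ
  have hev (x : ℚ) : P.eval x = ∏ m ∈ range κ, (x + y m) := by
    simp [hP, Polynomial.eval_prod]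
  have hinj : Set.InjOn (fun s : ℕ => -(s : ℚ)) (range (n + 1)) := by
    intro a _ b _ h
    simpa using h
  have h := congrArg (Polynomial.eval t) (Lagrange.eq_interpolate hinj hdeg)
  rw [Lagrange.eval_interpolate_not_at_node _ (fun s hs h => ht s hs (by rw [h]; simp)),
    Lagrange.eval_nodal, hev] at h
  have hprod : ∏ s ∈ range (n + 1), (t + s) ≠ 0 := prod_ne_zero_iff.2 ht
  simp only [sub_neg_eq_add] at h
  rw [h, mul_div_cancel_left₀ _ hprod]
  refine sum_congr rfl fun s hs => ?_
  rw [hev, Lagrange.nodalWeight, prod_inv_distrib,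
    ← prod_erase_natCast_sub (Nat.lt_succ_iff.1 (mem_range.1 hs))]
  have : ∏ j ∈ (range (n + 1)).erase s, (-(s : ℚ) - -(j : ℚ)) =
      ∏ j ∈ (range (n + 1)).erase s, ((j : ℚ) - s) := prod_congr rfl fun j _ => by ring
  rw [this, div_div, div_eq_mul_inv, mul_inv]
  ring

theorem factorial_div_prod_add (n : ℕ) {t : ℚ} (ht : ∀ s ∈ range (n + 1), t + s ≠ 0) :
    n.factorial / ∏ s ∈ range (n + 1), (t + s) =
      ∑ s ∈ range (n + 1), (((-1) ^ s * n.choose s : ℤ) : ℚ) / (t + s) := by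
  have h := prod_add_div_prod_add n n.zero_le (fun _ => 0) ht
  simp only [range_zero, prod_empty] at h
  rw [div_eq_mul_one_div, h, mul_sum]
  refine sum_congr rfl fun s hs => ?_
  have hs' : s ≤ n := Nat.lt_succ_iff.1 (mem_range.1 hs)
  rw [← mul_div_assoc]
  congr 1
  push_cast
  rw [Nat.cast_choose ℚ hs']
  have : ((-1 : ℚ) ^ s) * (-1) ^ s = 1 := by rw [← mul_pow]; simp
  have h1 : ((-1 : ℚ) ^ s) ≠ 0 := by positivity
  field_simp
  linear_combination -this

theorem prod_natCast_add_eq (n N : ℕ) : ∏ m ∈ range n, ((N : ℚ) + (m + 1)) =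
    n.factorial * (N + n).choose n := by
  have := Nat.ascFactorial_eq_factorial_mul_choose N n
  rw [Nat.ascFactorial_eq_prod_range] at this
  rw [← Nat.cast_mul, ← this]
  push_cast
  exact prod_congr rfl fun m _ => by ring

theorem prod_sub_div_prod_add (n N : ℕ) {t : ℚ} (ht : ∀ s ∈ range (n + 1), t + s ≠ 0) :
    (∏ m ∈ range n, (t - (N + (m + 1)))) / ∏ s ∈ range (n + 1), (t + s) =
      ∑ s ∈ range (n + 1),
        (((-1) ^ (n + s) * (n.choose s * (N + s + n).choose n) : ℤ) : ℚ) / (t + s) := by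
  have h := prod_add_div_prod_add n le_rfl (fun m => -(N + (m + 1))) ht
  simp only [← sub_eq_add_neg] at h
  rw [h]
  refine sum_congr rfl fun s hs => ?_
  have hs' : s ≤ n := Nat.lt_succ_iff.1 (mem_range.1 hs)
  congr 1
  have e : ∏ m ∈ range n, (-(s : ℚ) - (N + (m + 1))) =
      (-1) ^ n * (n.factorial * (N + s + n).choose n) := by
    rw [← prod_natCast_add_eq, ← card_range n, ← prod_const, card_range, ← prod_mul_distrib]
    exact prod_congr rfl fun m _ => by push_cast; ring
  rw [e]
  push_cast
  rw [Nat.cast_choose ℚ hs', pow_add]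
  have : ((-1 : ℚ) ^ s) * (-1) ^ s = 1 := by rw [← mul_pow]; simp
  have h1 : ((-1 : ℚ) ^ s) ≠ 0 := by positivity
  field_simp
  linear_combination -((N + s + n).choose n : ℚ) * this

theorem prod_add_add_div_prod_add (n N : ℕ) {t : ℚ} (ht : ∀ s ∈ range (n + 1), t + s ≠ 0) :
    (∏ m ∈ range n, (t + n + (N + (m + 1)))) / ∏ s ∈ range (n + 1), (t + s) =
      ∑ s ∈ range (n + 1),
        (((-1) ^ s * (n.choose s * (N + (n - s) + n).choose n) : ℤ) : ℚ) / (t + s) := by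
  have h := prod_add_div_prod_add n le_rfl (fun m => n + (N + (m + 1))) ht
  simp only [← add_assoc] at h ⊢
  rw [h]
  refine sum_congr rfl fun s hs => ?_
  have hs' : s ≤ n := Nat.lt_succ_iff.1 (mem_range.1 hs)
  congr 1
  have e : ∏ m ∈ range n, (-(s : ℚ) + n + N + m + 1) =
      n.factorial * (N + (n - s) + n).choose n := by
    rw [← prod_natCast_add_eq]
    refine prod_congr rfl fun m _ => ?_
    push_cast [Nat.cast_sub hs']
    ring
  rw [e]
  push_cast
  rw [Nat.cast_choose ℚ hs']
  have : ((-1 : ℚ) ^ s) * (-1) ^ s = 1 := by rw [← mul_pow]; simp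
  have h1 : ((-1 : ℚ) ^ s) ≠ 0 := by positivity
  field_simp
  linear_combination -((N + (n - s) + n).choose n : ℚ) * this

/-- The rational function of Ball and Rivoal,
`n! ^ q * ∏ (t - m) (t + n + m) / (∏ (t + s)) ^ (q + 2 r)`, where `1 ≤ m ≤ r n` and `0 ≤ s ≤ n`. -/
def ballRivoal (q r n : ℕ) (t : ℚ) : ℚ :=
  (n.factorial / ∏ s ∈ range (n + 1), (t + s)) ^ q *
    (∏ i ∈ range r,
      (∏ m ∈ range n, (t - ((i * n : ℕ) + (m + 1)))) / ∏ s ∈ range (n + 1), (t + s)) *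
    ∏ i ∈ range r,
      (∏ m ∈ range n, (t + n + ((i * n : ℕ) + (m + 1)))) / ∏ s ∈ range (n + 1), (t + s)

theorem choose_mul_pow_le {x : ℚ} (hx : 0 ≤ x) (M n : ℕ) : M.choose n * x ^ n ≤ (1 + x) ^ M := by
  rcases Nat.lt_or_ge M n with h | h
  · rw [Nat.choose_eq_zero_of_lt h]
    simp only [Nat.cast_zero, zero_mul]
    positivity
  rw [add_comm, add_pow]
  refine le_trans (le_of_eq ?_) (single_le_sum (f := fun m => x ^ m * 1 ^ (M - m) * (M.choose m : ℚ))
    (fun m _ => by positivity) (mem_range.2 (Nat.lt_succ_of_le h)))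
  simp [mul_comm]

/-- The exponential growth rate of `∑ s, C(n, s) C(i n + s + n, n)`. -/
def blockRate (i : ℕ) : ℚ := ((2 * i + 3) / (2 * i + 1)) ^ (i + 1) * (2 * i + 2)

theorem sum_choose_mul_choose_le (n i : ℕ) :
    ∑ s ∈ range (n + 1), (n.choose s * (i * n + s + n).choose n : ℚ) ≤ blockRate i ^ n := by
  set x : ℚ := 2 / (2 * i + 1) with hx
  have hx0 : 0 < x := by positivity
  have h1 : blockRate i = (1 + x) ^ (i + 1) * (1 + (1 + x)) / x := by
    rw [blockRate, hx, show 1 + 2 / (2 * (i : ℚ) + 1) = (2 * i + 3) / (2 * i + 1) by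
      field_simp; ring]
    field_simp
    ring
  rw [h1, div_pow, le_div_iff₀ (by positivity), sum_mul]
  calc _ ≤ ∑ s ∈ range (n + 1), (n.choose s : ℚ) * (1 + x) ^ (i * n + s + n) := by
        refine sum_le_sum fun s _ => ?_
        rw [mul_assoc]
        gcongr
        exact choose_mul_pow_le hx0.le _ _
    _ = (1 + x) ^ ((i + 1) * n) * (1 + (1 + x)) ^ n := by
        rw [add_comm 1 (1 + x), add_pow (1 + x) 1 n, mul_sum]
        refine sum_congr rfl fun s _ => ?_
        rw [one_pow]
        ring
    _ = _ := by rw [mul_pow, pow_mul]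

theorem ballRivoal_integralPartialFraction (q r n : ℕ) :
    IntegralPartialFraction n (q + 1 + r + r) (ballRivoal (q + 1) r n)
      ((q + 1 + r + r) ^ (q + r + r) * (2 ^ (q + 1) * (∏ i ∈ range r, blockRate i) ^ 2) ^ n) := by
  obtain ⟨e₀, he₀⟩ : ∃ e : ℕ → ℤ, e = fun s => (-1) ^ s * (n.choose s : ℤ) := ⟨_, rfl⟩
  obtain ⟨e₁, he₁⟩ : ∃ e : ℕ → ℕ → ℤ,
    e = fun i s => (-1) ^ (n + s) * (n.choose s * (i * n + s + n).choose n : ℤ) := ⟨_, rfl⟩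
  obtain ⟨e₂, he₂⟩ : ∃ e : ℕ → ℕ → ℤ,
    e = fun i s => (-1) ^ s * (n.choose s * (i * n + (n - s) + n).choose n : ℤ) := ⟨_, rfl⟩
  have hn₀ : ∑ s ∈ range (n + 1), |(e₀ s : ℚ)| = 2 ^ n := by
    have : ∀ s, |(e₀ s : ℚ)| = n.choose s := fun s => by simp [he₀, abs_mul]
    simp only [this]
    exact_mod_cast Nat.sum_range_choose n
  have hn₁ (i : ℕ) : ∑ s ∈ range (n + 1), |(e₁ i s : ℚ)| ≤ blockRate i ^ n := by
    refine le_trans (le_of_eq (sum_congr rfl fun s _ => ?_)) (sum_choose_mul_choose_le n i)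
    simp [he₁, abs_mul]
  have hn₂ (i : ℕ) : ∑ s ∈ range (n + 1), |(e₂ i s : ℚ)| ≤ blockRate i ^ n := by
    refine le_trans (le_of_eq ?_) (sum_choose_mul_choose_le n i)
    rw [← sum_range_reflect]
    refine sum_congr rfl fun s hs => ?_
    have hs' : s ≤ n := Nat.lt_succ_iff.1 (mem_range.1 hs)
    simp only [he₂, Nat.add_sub_cancel, Nat.sub_sub_self hs', Nat.choose_symm hs']
    simp [abs_mul]
  obtain ⟨K, hK⟩ : ∃ K : ℚ, K = q + 1 + r + r := ⟨_, rfl⟩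
  have hr0 : (0 : ℚ) ≤ r := Nat.cast_nonneg _
  have hK0 : 0 ≤ K := by rw [hK]; positivity
  have habs (e : ℕ → ℤ) : 0 ≤ ∑ s ∈ range (n + 1), |(e s : ℚ)| :=
    sum_nonneg fun s _ => abs_nonneg _
  have hprod (e : ℕ → ℕ → ℤ) (r : ℕ) : 0 ≤ ∏ i ∈ range r, ∑ s ∈ range (n + 1), |(e i s : ℚ)| :=
    prod_nonneg fun i _ => habs _
  have f₀ := (IntegralPartialFraction.one_pole (n := n) e₀).mul_prod (r := q) (K := K)
    (habs _) (fun _ => e₀) (by push_cast; linarith)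
  have p₀ := mul_nonneg (mul_nonneg (pow_nonneg hK0 q) (habs e₀)) (hprod (fun _ => e₀) q)
  have f₁ := f₀.mul_prod (r := r) (K := K) p₀ e₁ (by push_cast; linarith)
  have p₁ := mul_nonneg (mul_nonneg (pow_nonneg hK0 r) p₀) (hprod e₁ r)
  have f₂ := f₁.mul_prod (r := r) (K := K) p₁ e₂ (by push_cast; linarith)
  rw [show 1 + q + r + r = q + 1 + r + r by ring] at f₂
  refine f₂.congr (fun t ht => ?_) ?_
  · rw [ballRivoal, factorial_div_prod_add n ht]
    simp only [prod_sub_div_prod_add n _ ht, prod_add_add_div_prod_add n _ ht]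
    simp only [he₀, he₁, he₂, prod_const, card_range]
    rw [pow_succ']
  · have h1 : ∏ i ∈ range r, ∑ s ∈ range (n + 1), |(e₁ i s : ℚ)| ≤
        (∏ i ∈ range r, blockRate i) ^ n := by
      rw [← prod_pow]
      exact prod_le_prod (fun i _ => habs _) fun i _ => hn₁ i
    have h2 : ∏ i ∈ range r, ∑ s ∈ range (n + 1), |(e₂ i s : ℚ)| ≤
        (∏ i ∈ range r, blockRate i) ^ n := by
      rw [← prod_pow]
      exact prod_le_prod (fun i _ => habs _) fun i _ => hn₂ i
    have hB : 0 ≤ ∏ i ∈ range r, blockRate i :=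
      prod_nonneg fun i _ => by unfold blockRate; positivity
    rw [prod_const, card_range, hn₀]
    have h3 := hprod e₁ r
    have h4 := hprod e₂ r
    generalize ∏ i ∈ range r, ∑ s ∈ range (n + 1), |(e₁ i s : ℚ)| = P₁ at *
    generalize ∏ i ∈ range r, ∑ s ∈ range (n + 1), |(e₂ i s : ℚ)| = P₂ at *
    generalize ∏ i ∈ range r, blockRate i = B at *
    rw [← hK]
    calc _ = K ^ (q + r + r) * (2 ^ n) ^ (q + 1) * (P₁ * P₂) := by ring
      _ ≤ K ^ (q + r + r) * (2 ^ n) ^ (q + 1) * (B ^ n * B ^ n) := by gcongr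
      _ = _ := by ring

end

section

open Finset Filter Topology

/-- The generalized harmonic numbers. -/
def harmonicPow (s m : ℕ) : ℚ := ∑ k ∈ range m, 1 / ((k : ℚ) + 1) ^ s

theorem lcmUpto_pow_mul_harmonicPow_mem_range {n m : ℕ} (s : ℕ) (hm : m ≤ n) :
    (Nat.lcmUpto n : ℚ) ^ s * harmonicPow s m ∈ (Int.castRingHom ℚ).range := by
  rw [harmonicPow, mul_sum]
  refine sum_mem fun k hk => ?_
  have hk' := mem_range.1 hk
  have := pow_mem (div_mem_range_of_dvd (dvd_lcmUpto (i := k + 1) (n := n) (by omega) (by omega))) s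
  convert this using 1
  rw [div_pow, mul_one_div]
  push_cast
  rfl

theorem tendsto_harmonicPow {s : ℕ} (hs : 2 ≤ s) (j : ℕ) :
    Tendsto (fun K => (harmonicPow s (j + K) : ℝ)) atTop (𝓝 (zetaR s)) := by
  have h := (zetaR_summable hs).hasSum.tendsto_sum_nat.comp (tendsto_add_atTop_nat j)
  refine h.congr fun K => ?_
  simp [harmonicPow, add_comm]

theorem tendsto_harmonicPow_one_sub (j : ℕ) :
    Tendsto (fun K => (harmonicPow 1 (j + K) : ℝ) - harmonicPow 1 K) atTop (𝓝 0) := by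
  have h : Tendsto (fun K : ℕ => ∑ x ∈ range j, 1 / ((K : ℝ) + ((x : ℝ) + 1))) atTop (𝓝 0) := by
    rw [← sum_const_zero (s := range j)]
    refine tendsto_finsetSum _ fun x _ => ?_
    simp only [one_div]
    exact (tendsto_natCast_atTop_atTop.atTop_add tendsto_const_nhds).inv_tendsto_atTop
  refine h.congr fun K => ?_
  rw [add_comm j K, harmonicPow, harmonicPow, sum_range_add]
  push_cast
  simp [add_assoc]

namespace IntegralPartialFraction

variable {n b : ℕ} {F : ℚ → ℚ} {M : ℚ}

theorem exists_linear_form (hF : IntegralPartialFraction n b F M)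
    (hsymm : ∀ t : ℚ, (∀ s ∈ range (n + 1), t + s ≠ 0) → F (-n - t) = -F t)
    (hpos : ∀ k : ℕ, 0 ≤ F (k + 1)) {C : ℝ} (hC : ∀ k : ℕ, (F (k + 1) : ℝ) ≤ C / (k + 1) ^ 2) :
    ∃ (p₀ : ℚ) (p : ℕ → ℚ),
      2 * (Nat.lcmUpto n : ℚ) ^ b * p₀ ∈ (Int.castRingHom ℚ).range ∧
      (∀ i < b, 2 * (Nat.lcmUpto n : ℚ) ^ (b - 1 - i) * p i ∈ (Int.castRingHom ℚ).range) ∧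
      (∀ i < b, |p i| ≤ M) ∧ (∀ i < b, Odd i → p i = 0) ∧ (0 < b → p 0 = 0) ∧
      HasSum (fun k : ℕ => (F (k + 1) : ℝ)) (p₀ + ∑ i ∈ range b, p i * zetaR (i + 1)) := by
  obtain ⟨c, h1, h2, h3⟩ := hF
  set c' : ℕ → ℕ → ℚ := fun i j => (c i j + (-1) ^ i * c i (n - j)) / 2 with hc'
  have hrefl (i : ℕ) (f : ℕ → ℚ) : ∑ j ∈ range (n + 1), f (n - j) = ∑ j ∈ range (n + 1), f j := by
    rw [← sum_range_reflect]
    refine sum_congr rfl fun j hj => ?_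
    have := mem_range.1 hj
    congr 1
    omega
  have hF' (t : ℚ) (ht : ∀ s ∈ range (n + 1), t + s ≠ 0) :
      F t = ∑ i ∈ range b, ∑ j ∈ range (n + 1), c' i j / (t + j) ^ (i + 1) := by
    have ht' : ∀ s ∈ range (n + 1), -n - t + s ≠ 0 := by
      intro s hs h0
      have hs' : s ≤ n := Nat.lt_succ_iff.1 (mem_range.1 hs)
      refine ht (n - s) (mem_range.2 (by omega)) ?_
      push_cast [Nat.cast_sub hs']
      linarith
    have e1 : F t = (F t - F (-n - t)) / 2 := by rw [hsymm t ht]; ring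
    rw [e1, h1 t ht, h1 _ ht', ← sum_sub_distrib, sum_div]
    refine sum_congr rfl fun i _ => ?_
    rw [← hrefl i fun j => c i j / (-n - t + j) ^ (i + 1), ← sum_sub_distrib, sum_div]
    refine sum_congr rfl fun j hj => ?_
    have hj' : j ≤ n := Nat.lt_succ_iff.1 (mem_range.1 hj)
    have e2 : (-n - t + ((n - j : ℕ) : ℚ)) = (-1) * (t + j) := by
      push_cast [Nat.cast_sub hj']
      ring
    have h0 := ht j hj
    have hm : ((-1 : ℚ) ^ i) * (-1) ^ i = 1 := by rw [← mul_pow]; simp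
    have hm0 : ((-1 : ℚ) ^ i) ≠ 0 := by positivity
    rw [e2, mul_pow, pow_succ (-1 : ℚ), hc']
    field_simp
    linear_combination -c i (n - j) * hm
  have hnat (k : ℕ) : ∀ s ∈ range (n + 1), ((k : ℚ) + 1) + s ≠ 0 := fun s _ => by positivity
  have hp0 (hb : 0 < b) : ∑ j ∈ range (n + 1), c' 0 j = 0 := by
    have l1 : Tendsto (fun k : ℕ => ((k : ℝ) + 1) * F (k + 1)) atTop (𝓝 0) := by
      have hlim : Tendsto (fun k : ℕ => C / ((k : ℝ) + 1)) atTop (𝓝 0) :=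
        tendsto_const_nhds.div_atTop (tendsto_natCast_atTop_atTop.atTop_add tendsto_const_nhds)
      refine squeeze_zero (fun k => ?_) (fun k => ?_) hlim
      · have : (0 : ℝ) ≤ F (k + 1) := by exact_mod_cast hpos k
        positivity
      · calc ((k : ℝ) + 1) * F (k + 1) ≤ (k + 1) * (C / (k + 1) ^ 2) := by gcongr; exact hC k
          _ = _ := by field_simp
    have l2 : Tendsto (fun k : ℕ => ((k : ℝ) + 1) * F (k + 1)) atTop
        (𝓝 (∑ i ∈ range b, ∑ j ∈ range (n + 1), if i = 0 then (c' 0 j : ℝ) else 0)) := by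
      have e : (fun k : ℕ => ((k : ℝ) + 1) * F (k + 1)) = fun k : ℕ =>
          ∑ i ∈ range b, ∑ j ∈ range (n + 1),
            c' i j * (((k : ℝ) + 1) / (k + 1 + j)) * (1 / ((k : ℝ) + 1 + j)) ^ i := by
        funext k
        rw [hF' _ (hnat k)]
        push_cast
        rw [mul_sum]
        refine sum_congr rfl fun i _ => ?_
        rw [mul_sum]
        refine sum_congr rfl fun j _ => ?_
        rw [one_div, inv_pow, pow_succ]
        field_simp
      rw [e]
      refine tendsto_finsetSum _ fun i _ => tendsto_finsetSum _ fun j _ => ?_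
      have t1 : Tendsto (fun k : ℕ => 1 / ((k : ℝ) + 1 + j)) atTop (𝓝 0) :=
        tendsto_const_nhds.div_atTop ((tendsto_natCast_atTop_atTop.atTop_add
          tendsto_const_nhds).atTop_add tendsto_const_nhds)
      have t2 : Tendsto (fun k : ℕ => ((k : ℝ) + 1) / (k + 1 + j)) atTop (𝓝 1) := by
        have : Tendsto (fun k : ℕ => 1 - j * (1 / ((k : ℝ) + 1 + j))) atTop (𝓝 (1 - j * 0)) :=
          tendsto_const_nhds.sub (t1.const_mul _)
        rw [mul_zero, sub_zero] at this
        refine this.congr fun k => ?_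
        field_simp
        ring
      have t3 := (t2.const_mul (c' i j : ℝ)).mul (t1.pow i)
      convert t3 using 2
      rcases eq_or_ne i 0 with rfl | hi
      · simp
      · simp [hi]
    have h0 := tendsto_nhds_unique l1 l2
    rw [sum_eq_single_of_mem 0 (mem_range.2 hb) (fun i _ hi => by simp [hi])] at h0
    simp only [if_true] at h0
    exact_mod_cast h0.symm
  have hc_int (i : ℕ) (hi : i ∈ range b) (j : ℕ) (hj : j ∈ range (n + 1)) :
      2 * (Nat.lcmUpto n : ℚ) ^ (b - 1 - i) * c' i j ∈ (Int.castRingHom ℚ).range := by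
    have hj' : n - j ∈ range (n + 1) := mem_range.2 (by omega)
    convert add_mem (h2 i hi j hj) (mul_mem (pow_mem (neg_mem (one_mem _)) i) (h2 i hi _ hj'))
      using 1
    simp only [hc']
    ring
  refine ⟨-∑ i ∈ range b, ∑ j ∈ range (n + 1), c' i j * harmonicPow (i + 1) j,
    fun i => ∑ j ∈ range (n + 1), c' i j, ?_, fun i hi => ?_, fun i hi => ?_, fun i hi hodd => ?_,
    hp0, ?_⟩
  · rw [mul_neg, mul_sum]
    refine neg_mem (sum_mem fun i hi => ?_)
    rw [mul_sum]
    refine sum_mem fun j hj => ?_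
    have hi' := mem_range.1 hi
    convert mul_mem (hc_int i hi j hj) (lcmUpto_pow_mul_harmonicPow_mem_range (i + 1)
      (Nat.lt_succ_iff.1 (mem_range.1 hj))) using 1
    rw [show (Nat.lcmUpto n : ℚ) ^ b =
      (Nat.lcmUpto n : ℚ) ^ (b - 1 - i) * (Nat.lcmUpto n : ℚ) ^ (i + 1) by
        rw [← pow_add]; congr 1; omega]
    ring
  · rw [mul_sum]
    exact sum_mem fun j hj => hc_int i (mem_range.2 hi) j hj
  · refine le_trans ?_ h3
    calc _ ≤ ∑ j ∈ range (n + 1), |c' i j| := abs_sum_le_sum_abs _ _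
      _ ≤ ∑ j ∈ range (n + 1), (|c i j| + |c i (n - j)|) / 2 := by
        refine sum_le_sum fun j _ => ?_
        rw [hc', abs_div, abs_two]
        gcongr
        refine (abs_add_le _ _).trans (le_of_eq ?_)
        rw [abs_mul, abs_pow, abs_neg, abs_one, one_pow, one_mul]
      _ = ∑ j ∈ range (n + 1), |c i j| := by
        rw [← sum_div, sum_add_distrib, hrefl i fun j => |c i j|]
        ring
      _ ≤ _ := single_le_sum (f := fun i => ∑ j ∈ range (n + 1), |c i j|)
        (fun i _ => sum_nonneg fun j _ => abs_nonneg _) (mem_range.2 hi)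
  · simp only [hc']
    rw [← sum_div, sum_add_distrib, ← mul_sum, hrefl i fun j => c i j, hodd.neg_one_pow]
    ring
  · rw [hasSum_iff_tendsto_nat_of_nonneg (fun k => by exact_mod_cast hpos k)]
    have e (K : ℕ) : ∑ k ∈ range K, (F (k + 1) : ℝ) = ∑ i ∈ range b, ∑ j ∈ range (n + 1),
        (c' i j : ℝ) * ((harmonicPow (i + 1) (j + K) - if i = 0 then (harmonicPow 1 K : ℝ) else 0) -
          harmonicPow (i + 1) j) := by
      have e1 : ∑ k ∈ range K, (F (k + 1) : ℝ) = ∑ i ∈ range b, ∑ j ∈ range (n + 1),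
          (c' i j : ℝ) * (harmonicPow (i + 1) (j + K) - harmonicPow (i + 1) j) := by
        have : ∑ k ∈ range K, F (k + 1) = ∑ i ∈ range b, ∑ j ∈ range (n + 1),
            c' i j * (harmonicPow (i + 1) (j + K) - harmonicPow (i + 1) j) := by
          rw [sum_congr rfl fun k _ => hF' _ (hnat k), sum_comm]
          refine sum_congr rfl fun i _ => ?_
          rw [sum_comm]
          refine sum_congr rfl fun j _ => ?_
          rw [harmonicPow, sum_range_add, ← harmonicPow, add_sub_cancel_left, mul_sum]
          refine sum_congr rfl fun k _ => ?_
          push_cast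
          rw [mul_one_div]
          congr 2
          ring
        exact_mod_cast congrArg (fun x : ℚ => (x : ℝ)) this
      have e2 (i : ℕ) (hi : i ∈ range b) :
          ∑ j ∈ range (n + 1), (c' i j : ℝ) * (if i = 0 then (harmonicPow 1 K : ℝ) else 0) = 0 := by
        rcases eq_or_ne i 0 with rfl | hi0
        · have : ∑ j ∈ range (n + 1), (c' 0 j : ℝ) = 0 := by
            exact_mod_cast hp0 (Nat.zero_lt_of_lt (mem_range.1 hi))
          rw [← sum_mul, this, zero_mul]
        · simp [hi0]
      rw [e1]
      refine sum_congr rfl fun i hi => ?_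
      refine Eq.trans (b := _ - ∑ j ∈ range (n + 1), (c' i j : ℝ) *
        (if i = 0 then (harmonicPow 1 K : ℝ) else 0)) (by rw [e2 i hi, sub_zero]) ?_
      rw [← sum_sub_distrib]
      exact sum_congr rfl fun j _ => by ring
    simp only [e]
    have e3 : (((-∑ i ∈ range b, ∑ j ∈ range (n + 1), c' i j * harmonicPow (i + 1) j : ℚ) : ℝ) +
        ∑ i ∈ range b, ((∑ j ∈ range (n + 1), c' i j : ℚ) : ℝ) * zetaR (i + 1)) =
        ∑ i ∈ range b, ∑ j ∈ range (n + 1), (c' i j : ℝ) *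
          ((if i = 0 then 0 else zetaR (i + 1)) - harmonicPow (i + 1) j) := by
      push_cast
      rw [neg_add_eq_sub, ← sum_sub_distrib]
      refine sum_congr rfl fun i hi => ?_
      simp only [mul_sub, sum_sub_distrib, ← sum_mul]
      congr 1
      rcases eq_or_ne i 0 with rfl | hi0
      · have : ∑ j ∈ range (n + 1), (c' 0 j : ℝ) = 0 := by
          exact_mod_cast hp0 (Nat.zero_lt_of_lt (mem_range.1 hi))
        simp [this]
      · simp [hi0]
    rw [e3]
    refine tendsto_finsetSum _ fun i _ => tendsto_finsetSum _ fun j _ =>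
      Tendsto.const_mul _ (Tendsto.sub_const ?_ _)
    rcases eq_or_ne i 0 with rfl | hi0
    · simpa using tendsto_harmonicPow_one_sub j
    · simpa [hi0] using tendsto_harmonicPow (s := i + 1) (by omega) j

end IntegralPartialFraction

end

section

open Finset

theorem prod_range_neg_sub_add (n : ℕ) (t : ℚ) :
    ∏ s ∈ range (n + 1), (-n - t + s) = (-1) ^ (n + 1) * ∏ s ∈ range (n + 1), (t + s) := by
  have h := prod_neg (s := range (n + 1)) (f := fun s : ℕ => t + s)
  rw [card_range] at h
  rw [← prod_range_reflect, ← h]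
  refine prod_congr rfl fun s hs => ?_
  rw [show n + 1 - 1 - s = n - s by omega, Nat.cast_sub (by have := mem_range.1 hs; omega)]
  ring

theorem ballRivoal_neg_sub {q n : ℕ} (r : ℕ) (hq : Odd q) (hn : Even n) (t : ℚ) :
    ballRivoal q r n (-n - t) = -ballRivoal q r n t := by
  have h1 (i : ℕ) : ∏ m ∈ range n, (-n - t - ((i * n : ℕ) + (m + 1))) =
      ∏ m ∈ range n, (t + n + ((i * n : ℕ) + (m + 1))) := by
    rw [← one_mul (∏ m ∈ range n, (t + n + ((i * n : ℕ) + (m + 1)))), ← hn.neg_one_pow]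
    conv_rhs => enter [1]; rw [← card_range n, ← prod_const]
    rw [← prod_mul_distrib]
    exact prod_congr rfl fun m _ => by ring
  have h2 (i : ℕ) : ∏ m ∈ range n, (-n - t + n + ((i * n : ℕ) + (m + 1))) =
      ∏ m ∈ range n, (t - ((i * n : ℕ) + (m + 1))) := by
    rw [← one_mul (∏ m ∈ range n, (t - ((i * n : ℕ) + (m + 1)))), ← hn.neg_one_pow]
    conv_rhs => enter [1]; rw [← card_range n, ← prod_const]
    rw [← prod_mul_distrib]
    exact prod_congr rfl fun m _ => by ring
  simp only [ballRivoal, h1, h2, prod_range_neg_sub_add, hn.add_one.neg_one_pow, neg_mul, one_mul,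
    div_neg, prod_neg, card_range, hq.neg_pow]
  have : ((-1 : ℚ) ^ r) * (-1) ^ r = 1 := by rw [← mul_pow]; simp
  linear_combination (-(n.factorial / ∏ s ∈ range (n + 1), (t + s)) ^ q *
    (∏ i ∈ range r,
      (∏ m ∈ range n, (t - ((i * n : ℕ) + (m + 1)))) / ∏ s ∈ range (n + 1), (t + s)) *
    ∏ i ∈ range r,
      (∏ m ∈ range n, (t + n + ((i * n : ℕ) + (m + 1)))) / ∏ s ∈ range (n + 1), (t + s)) * this

theorem ballRivoal_eq_zero (q : ℕ) {r n k : ℕ} (hk : k < r * n) :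
    ballRivoal q r n (k + 1) = 0 := by
  have hn : 0 < n := Nat.pos_of_ne_zero fun h => by simp [h] at hk
  have h1 : k / n < r := (Nat.div_lt_iff_lt_mul hn).2 hk
  rw [ballRivoal, prod_eq_zero (i := k / n) (mem_range.2 h1), mul_zero, zero_mul]
  rw [prod_eq_zero (i := k % n) (mem_range.2 (Nat.mod_lt _ hn)), zero_div]
  have : (k : ℚ) = (k / n * n : ℕ) + (k % n : ℕ) := by exact_mod_cast (Nat.div_add_mod' k n).symm
  linear_combination this

theorem mul_add_add_one_le_mul {r n i m : ℕ} (hi : i < r) (hm : m < n) :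
    i * n + (m + 1) ≤ r * n := by
  nlinarith [Nat.mul_le_mul_right n (Nat.succ_le_of_lt hi)]

theorem ballRivoal_pos (q : ℕ) {r n k : ℕ} (hk : r * n ≤ k) : 0 < ballRivoal q r n (k + 1) := by
  have hP : 0 < ∏ s ∈ range (n + 1), ((k : ℚ) + 1 + s) := prod_pos fun s _ => by positivity
  refine mul_pos (mul_pos (by positivity) (prod_pos fun i hi => div_pos (prod_pos fun m hm => ?_) hP))
    (prod_pos fun i _ => div_pos (prod_pos fun m _ => by positivity) hP)
  have := mul_add_add_one_le_mul (mem_range.1 hi) (mem_range.1 hm)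
  have : ((i * n : ℕ) : ℚ) + (m + 1) ≤ k := by exact_mod_cast this.trans hk
  linarith

theorem ballRivoal_nonneg (q r n k : ℕ) : 0 ≤ ballRivoal q r n (k + 1) := by
  rcases Nat.lt_or_ge k (r * n) with h | h
  · exact (ballRivoal_eq_zero q h).ge
  · exact (ballRivoal_pos q h).le

theorem eventually_factorial_le_pow {c : ℝ} (hc : 0 < c) (hc' : c < Real.exp 1) :
    ∀ᶠ n : ℕ in Filter.atTop, (n.factorial : ℝ) ≤ (n / c) ^ n := by
  have h1 : Filter.Tendsto (fun n : ℕ => (n : ℝ) ^ 1 * (c / Real.exp 1) ^ n) Filter.atTop (nhds 0) :=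
    tendsto_pow_const_mul_const_pow_of_abs_lt_one 1 (by
      rw [abs_of_pos (by positivity), div_lt_one (Real.exp_pos 1)]; exact hc')
  have h2 := Stirling.tendsto_stirlingSeq_sqrt_pi.eventually_lt_const
    (show √Real.pi < 2 by
      rw [Real.sqrt_lt' two_pos]; linarith [Real.pi_lt_four])
  filter_upwards [h1.eventually_lt_const (show (0 : ℝ) < 1 / 4 by norm_num), h2,
    Filter.eventually_ge_atTop 1] with n h1 h2 hn
  have hn0 : (1 : ℝ) ≤ n := by exact_mod_cast hn
  rw [Stirling.stirlingSeq, div_lt_iff₀ (by positivity)] at h2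
  have h3 : √(2 * n : ℝ) ≤ 2 * n := by
    rw [Real.sqrt_le_left (by positivity)]; nlinarith
  have h4 : (n / Real.exp 1) ^ n = (c / Real.exp 1) ^ n * (n / c : ℝ) ^ n := by
    rw [← mul_pow]; congr 1; field_simp
  calc (n.factorial : ℝ) ≤ 2 * (2 * n * (n / Real.exp 1) ^ n) := by
        refine h2.le.trans ?_; gcongr
    _ = 4 * ((n : ℝ) ^ 1 * (c / Real.exp 1) ^ n) * (n / c) ^ n := by rw [h4]; ring
    _ ≤ 1 * (n / c : ℝ) ^ n := by gcongr; linarith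
    _ = _ := one_mul _

theorem prod_range_two_mul_add_one (N : ℕ) (t : ℚ) :
    ∏ s ∈ range (2 * N + 1), (t + s) = (t + N) * ∏ h ∈ range N, ((t + N) ^ 2 - (h + 1) ^ 2) := by
  induction N generalizing t with
  | zero => simp
  | succ N ih =>
    rw [show 2 * (N + 1) + 1 = 2 * N + 1 + 1 + 1 by ring, prod_range_succ,
      prod_range_succ' _ (2 * N + 1), prod_range_succ _ N]
    have := ih (t + 1)
    have h1 : ∏ s ∈ range (2 * N + 1), (t + ((s + 1 : ℕ) : ℚ)) =
      ∏ s ∈ range (2 * N + 1), (t + 1 + s) := prod_congr rfl fun s _ => by push_cast; ring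
    have h2 : ∏ h ∈ range N, ((t + 1 + N) ^ 2 - ((h : ℚ) + 1) ^ 2) =
      ∏ h ∈ range N, ((t + (N + 1 : ℕ)) ^ 2 - ((h : ℚ) + 1) ^ 2) :=
        prod_congr rfl fun s _ => by push_cast; ring
    rw [h1, this, h2]
    push_cast
    ring

theorem mul_pow_le_prod_range_add {N : ℕ} {t δ : ℚ} (ht : 0 ≤ t)
    (h : N ^ 2 ≤ (1 - δ) * (t + N) ^ 2) (hδ : 0 ≤ δ) :
    (t + N) * (δ * (t + N) ^ 2) ^ N ≤ ∏ s ∈ range (2 * N + 1), (t + s) := by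
  rw [prod_range_two_mul_add_one]
  gcongr
  rw [← card_range N, ← prod_const, card_range]
  refine prod_le_prod (fun _ _ => by positivity) fun i hi => ?_
  have : (i + 1 : ℚ) ≤ N := by exact_mod_cast mem_range.1 hi
  have : (i + 1 : ℚ) ^ 2 ≤ N ^ 2 := by gcongr
  linarith

theorem prod_sub_mul_prod_add_le {N i : ℕ} {t : ℚ} (ht : ∀ m < 2 * N, (i * (2 * N) + (m + 1) : ℚ) ≤ t) :
    (∏ m ∈ range (2 * N), (t - ((i * (2 * N) : ℕ) + (m + 1)))) *
      ∏ m ∈ range (2 * N), (t + (2 * N : ℕ) + ((i * (2 * N) : ℕ) + (m + 1))) ≤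
      ((t + N) ^ 2 - ((2 * i + 1) * N) ^ 2) ^ (2 * N) := by
  rw [← prod_mul_distrib]
  conv_rhs => enter [2]; rw [← card_range (2 * N)]
  rw [← prod_const]
  refine prod_le_prod (fun m hm => ?_) fun m hm => ?_
  · have := ht m (mem_range.1 hm)
    push_cast
    exact mul_nonneg (by linarith) (by have : (0 : ℚ) ≤ i * (2 * N) + (m + 1) := by positivity
                                       linarith)
  · push_cast
    have : ((2 * i + 1) * N : ℚ) ^ 2 ≤ (i * (2 * N) + (m + 1) + N) ^ 2 := by
      gcongr
      have : (0 : ℚ) ≤ m := Nat.cast_nonneg m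
      linarith
    linarith

theorem ballRivoal_le {q r N k : ℕ} (hk : r * (2 * N) ≤ k) {y δ : ℚ} (hy : y = k + 1 + N)
    (hδ : 0 < δ) (h : N ^ 2 ≤ (1 - δ) * y ^ 2) :
    ballRivoal q r (2 * N) (k + 1) ≤ ((2 * N).factorial ^ q *
      (∏ i ∈ range r, (y ^ 2 - (2 * i + 1) ^ 2 * N ^ 2)) ^ (2 * N)) /
        (y * (δ * y ^ 2) ^ N) ^ (q + r + r) := by
  have hP := mul_pow_le_prod_range_add (N := N) (t := k + 1) (δ := δ) (by positivity)
    (by rwa [← hy]) hδ.le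
  rw [← hy] at hP
  have hy0 : 0 < y := by rw [hy]; positivity
  have hc (i : ℕ) (hi : i ∈ range r) (m : ℕ) (hm : m < 2 * N) :
      (i * (2 * N) + (m + 1) : ℚ) ≤ k + 1 := by
    have : ((i * (2 * N) + (m + 1) : ℕ) : ℚ) ≤ k := by
      exact_mod_cast (mul_add_add_one_le_mul (mem_range.1 hi) hm).trans hk
    push_cast at this
    linarith
  simp only [ballRivoal, div_pow, prod_div_distrib, prod_const, card_range]
  rw [div_mul_div_comm, div_mul_div_comm, ← pow_add, ← pow_add, mul_assoc, ← prod_mul_distrib,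
    ← prod_pow _ (2 * N)]
  have h0 (i : ℕ) (hi : i ∈ range r) : 0 ≤ (∏ m ∈ range (2 * N), ((k : ℚ) + 1 - ((i * (2 * N) : ℕ) + (m + 1)))) *
      ∏ m ∈ range (2 * N), ((k : ℚ) + 1 + (2 * N : ℕ) + ((i * (2 * N) : ℕ) + (m + 1))) := by
    refine mul_nonneg (prod_nonneg fun m hm => ?_) (prod_nonneg fun m hm => by positivity)
    have := hc i hi m (mem_range.1 hm)
    push_cast
    linarith
  have h1 (i : ℕ) (hi : i ∈ range r) := prod_sub_mul_prod_add_le (hc i hi)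
  simp only [← hy, mul_pow ((2 * _ + 1 : ℚ)) (N : ℚ) 2] at h1
  have h2 := prod_le_prod h0 h1
  have h3 := prod_nonneg h0
  have h4 := mul_nonneg (pow_nonneg (Nat.cast_nonneg (α := ℚ) (2 * N).factorial) q) (h3.trans h2)
  gcongr

theorem pow_six_mul_sub_le {X Y ω α : ℚ} (hX : 0 ≤ X) (hXY : X ≤ ω * Y) (hY : 0 < Y)
    (hα : 0 ≤ α) (hα' : 7 * α * ω ≤ 6) (hω : 0 ≤ ω) :
    X ^ 6 * (Y - α * X) ≤ ω ^ 6 * (1 - α * ω) * Y ^ 7 := by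
  obtain ⟨Z, hZd⟩ : ∃ Z, Z = ω * Y := ⟨_, rfl⟩
  have hZ : 0 ≤ Z := by rw [hZd]; positivity
  rw [← hZd] at hXY
  have h1 : ω ^ 6 * (1 - α * ω) * Y ^ 7 = Z ^ 6 * (Y - α * Z) := by rw [hZd]; ring
  have h2 : 7 * α * Z ≤ 6 * Y := by rw [hZd]; nlinarith
  rw [h1]
  have h3 : 0 ≤ α * ((Z - X) ^ 2 *
      (Z ^ 5 + 2 * Z ^ 4 * X + 3 * Z ^ 3 * X ^ 2 + 4 * Z ^ 2 * X ^ 3 + 5 * Z * X ^ 4 + 6 * X ^ 5)) :=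
    by positivity
  have h4 : X ^ 6 ≤ Z ^ 6 := by gcongr
  have h5 : 0 ≤ (Z ^ 6 - X ^ 6) * (6 * Y - 7 * α * Z) :=
    mul_nonneg (by linarith) (by linarith)
  linarith

/-- The exponential rate, in `N`, of `∑ k, ballRivoal 147 11 (2 * N) (k + 1)`. -/
def ballRivoalRate : ℚ :=
  (4 / (2.718 ^ 2 * 529)) ^ 147 * (∏ i ∈ range 11, (1 - (2 * (i : ℚ) + 1) ^ 2 / 529)) ^ 2 *
    (529 / 528) ^ 169

theorem ballRivoal_le_rate_pow {N k : ℕ} (hN : 0 < N)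
    (hfac : ((2 * N).factorial : ℚ) ≤ ((2 * N : ℕ) / 2.718) ^ (2 * N)) :
    ballRivoal 147 11 (2 * N) (k + 1) ≤ ballRivoalRate ^ N / (k + 1) ^ 2 := by
  obtain ⟨c, hc⟩ : ∃ c : ℚ, c = 2.718 := ⟨_, rfl⟩
  obtain ⟨ω, hω⟩ : ∃ ω : ℚ, ω = 1 / 529 := ⟨_, rfl⟩
  obtain ⟨δ, hδ⟩ : ∃ δ : ℚ, δ = 528 / 529 := ⟨_, rfl⟩
  obtain ⟨K, hK⟩ : ∃ K : ℚ, K = ∏ i ∈ range 11, (1 - (2 * (i : ℚ) + 1) ^ 2 * ω) := ⟨_, rfl⟩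
  have hrate : ballRivoalRate = (4 / c ^ 2) ^ 147 * (ω ^ 147 * K ^ 2) / δ ^ 169 := by
    rw [ballRivoalRate, hK, hc, hω, hδ, div_eq_mul_inv _ ((_ : ℚ) ^ 169), ← inv_pow, inv_div,
      ← mul_assoc _ ((_ : ℚ) ^ 147), ← mul_pow]
    simp only [mul_one_div, div_div]
  have hω0 : 0 ≤ ω := by rw [hω]; norm_num
  have hδ0 : 0 < δ := by rw [hδ]; norm_num
  have hc0 : 0 < c := by rw [hc]; norm_num
  have hα (i : ℕ) (hi : i ∈ range 11) : (2 * i + 1 : ℚ) ^ 2 ≤ 441 := by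
    have : (i : ℚ) ≤ 10 := by exact_mod_cast Nat.le_of_lt_succ (mem_range.1 hi)
    have : (2 * i + 1 : ℚ) ≤ 21 := by linarith
    calc _ ≤ (21 : ℚ) ^ 2 := by gcongr
      _ = 441 := by norm_num
  have hrate0 : 0 ≤ ballRivoalRate := by
    rw [hrate]; positivity
  rcases Nat.lt_or_ge k (11 * (2 * N)) with hk | hk
  · rw [ballRivoal_eq_zero _ hk]
    positivity
  obtain ⟨y, hy⟩ : ∃ y : ℚ, y = k + 1 + N := ⟨_, rfl⟩
  have hN1 : (1 : ℚ) ≤ N := by exact_mod_cast hN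
  have hk' : 11 * (2 * N : ℚ) ≤ k := by exact_mod_cast hk
  have hy0 : 1 ≤ y := by rw [hy]; linarith
  have hNy : (N : ℚ) ^ 2 ≤ ω * y ^ 2 := by
    have : (23 * N : ℚ) ^ 2 ≤ y ^ 2 := by gcongr; linarith
    rw [hω]; linarith
  have h1 := ballRivoal_le (q := 147) hk hy hδ0 (by rwa [show 1 - δ = ω by rw [hδ, hω]; norm_num])
  refine h1.trans ?_
  obtain ⟨X, hX⟩ : ∃ X : ℚ, X = N ^ 2 := ⟨_, rfl⟩
  obtain ⟨Y, hY⟩ : ∃ Y : ℚ, Y = y ^ 2 := ⟨_, rfl⟩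
  have hX0 : 0 ≤ X := by rw [hX]; positivity
  have hY0 : 0 < Y := by rw [hY]; positivity
  rw [← hX, ← hY] at hNy ⊢
  obtain ⟨Q, hQ⟩ : ∃ Q : ℚ, Q = ∏ i ∈ range 11, (Y - (2 * (i : ℚ) + 1) ^ 2 * X) := ⟨_, rfl⟩
  rw [← hQ]
  have hα0 (i : ℕ) (hi : i ∈ range 11) : 0 ≤ Y - (2 * (i : ℚ) + 1) ^ 2 * X := by
    have := mul_le_mul (hα i hi) hNy hX0 (by norm_num)
    rw [hω] at this
    linarith
  have hQ0 : 0 ≤ Q := by rw [hQ]; exact prod_nonneg hα0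
  have h2 : X ^ 66 * Q ≤ ω ^ 66 * K * Y ^ 77 := by
    have := prod_le_prod (fun i hi => mul_nonneg (pow_nonneg hX0 6) (hα0 i hi)) fun i hi =>
      pow_six_mul_sub_le hX0 hNy hY0 (sq_nonneg (2 * (i : ℚ) + 1))
        (by rw [hω]; linarith [hα i hi]) hω0
    simp only [prod_mul_distrib, prod_const, card_range, ← hQ, ← hK, ← pow_mul] at this
    exact this
  have h3 : X ^ 147 * Q ^ 2 ≤ ω ^ 147 * K ^ 2 * Y ^ 169 := by
    calc X ^ 147 * Q ^ 2 = X ^ 15 * (X ^ 66 * Q) ^ 2 := by ring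
      _ ≤ (ω * Y) ^ 15 * (ω ^ 66 * K * Y ^ 77) ^ 2 := by gcongr
      _ = _ := by ring
  have h4 : ((2 * N).factorial : ℚ) ^ 147 ≤ (((4 / c ^ 2) * X) ^ 147) ^ N := by
    calc _ ≤ (((2 * N : ℕ) / c : ℚ) ^ (2 * N)) ^ 147 := by rw [hc]; gcongr
      _ = _ := by
        rw [hX, ← pow_mul, ← pow_mul, mul_assoc, pow_mul, mul_comm 147]
        congr 1
        push_cast
        ring
  rw [div_le_div_iff₀ (by positivity) (by positivity), hrate]
  have h5 : ((k : ℚ) + 1) ^ 2 ≤ y ^ 169 := by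
    calc ((k : ℚ) + 1) ^ 2 ≤ y ^ 2 := by gcongr; rw [hy]; linarith
      _ ≤ _ := pow_le_pow_right₀ hy0 (by norm_num)
  calc ((2 * N).factorial : ℚ) ^ 147 * Q ^ (2 * N) * (k + 1) ^ 2
      ≤ (((4 / c ^ 2) * X) ^ 147) ^ N * Q ^ (2 * N) * y ^ 169 := by gcongr
    _ = ((4 / c ^ 2) ^ 147) ^ N * (X ^ 147 * Q ^ 2) ^ N * y ^ 169 := by
      rw [mul_pow (4 / c ^ 2), mul_pow _ _ N, mul_pow _ _ N, pow_mul]; ring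
    _ ≤ ((4 / c ^ 2) ^ 147) ^ N * (ω ^ 147 * K ^ 2 * Y ^ 169) ^ N * y ^ 169 := by gcongr
    _ = _ := by
      have h6 : ((δ * Y) ^ N) ^ 169 = (δ ^ 169 * Y ^ 169) ^ N := by
        rw [pow_right_comm, mul_pow δ]
      have h7 : δ ^ 169 ≠ 0 := by positivity
      rw [show 147 + 11 + 11 = 169 by norm_num, mul_pow y, h6, div_pow _ (δ ^ 169), mul_pow _ (Y ^ 169) N,
        mul_pow (δ ^ 169) _ N, mul_pow ((4 / c ^ 2) ^ 147) _ N]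
      field_simp

/-- The exponential rate, in `n`, of the coefficients of the partial fractions of
`ballRivoal 147 11 n`. -/
def coeffRate : ℚ := 2 ^ 147 * (∏ i ∈ range 11, blockRate i) ^ 2

set_option exponentiation.threshold 2000 in
theorem ballRivoalRate_mul_lt_one : ballRivoalRate * coeffRate ^ 2 * 2.72 ^ 670 < 1 := by
  rw [ballRivoalRate, coeffRate]
  simp only [prod_range_succ, range_zero, prod_empty, blockRate]
  norm_num

set_option exponentiation.threshold 2000 in
theorem one_le_coeffRate : 1 ≤ coeffRate := by
  rw [coeffRate]
  simp only [prod_range_succ, range_zero, prod_empty, blockRate]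
  norm_num

end

section

open Finset Filter Topology

theorem ballRivoalRate_nonneg : 0 ≤ ballRivoalRate := by
  rw [ballRivoalRate]; positivity

theorem eventually_exists_ballRivoal_form : ∃ B : ℝ, 0 ≤ B ∧ ∀ᶠ N : ℕ in atTop,
    ∃ (p₀ : ℚ) (p : ℕ → ℚ),
      2 * (Nat.lcmUpto (2 * N) : ℚ) ^ 169 * p₀ ∈ (Int.castRingHom ℚ).range ∧
      (∀ i < 169, 2 * (Nat.lcmUpto (2 * N) : ℚ) ^ (168 - i) * p i ∈ (Int.castRingHom ℚ).range) ∧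
      (∀ i < 169, |(p i : ℝ)| ≤ B * coeffRate ^ (2 * N)) ∧
      (∀ i < 169, Odd i → p i = 0) ∧ p 0 = 0 ∧
      0 < p₀ + ∑ i ∈ range 169, p i * zetaR (i + 1) ∧
      p₀ + ∑ i ∈ range 169, p i * zetaR (i + 1) ≤ B * ballRivoalRate ^ N := by
  obtain ⟨A, hA⟩ : ∃ A : ℚ, A = ((146 : ℕ) + 1 + (11 : ℕ) + (11 : ℕ)) ^ (146 + 11 + 11) := ⟨_, rfl⟩
  have hA0 : 0 ≤ A := by rw [hA]; positivity
  have hz0 : 0 ≤ zetaR 2 := tsum_nonneg fun n => by positivity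
  refine ⟨A + zetaR 2, by positivity, ?_⟩
  have h2 := (tendsto_id.const_mul_atTop' (zero_lt_two (α := ℕ))).eventually
    (eventually_factorial_le_pow (c := 2.718) (by norm_num)
      (by have := Real.exp_one_gt_d9; norm_num at this ⊢; linarith))
  filter_upwards [h2, eventually_gt_atTop 0] with N hfac hN
  have hfac' : ((2 * N).factorial : ℚ) ≤ ((2 * N : ℕ) / 2.718) ^ (2 * N) := by
    have h := (Rat.cast_le (K := ℝ)).1 (show (((2 * N).factorial : ℚ) : ℝ) ≤
      ((((2 * N : ℕ) / 2.718) ^ (2 * N) : ℚ) : ℝ) by push_cast at hfac ⊢; exact hfac)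
    exact h
  have hle (k : ℕ) := ballRivoal_le_rate_pow (k := k) hN hfac'
  have hle' (k : ℕ) : (ballRivoal 147 11 (2 * N) (k + 1) : ℝ) ≤ ballRivoalRate ^ N / (k + 1) ^ 2 := by
    exact_mod_cast (Rat.cast_le (K := ℝ)).2 (hle k)
  obtain ⟨p₀, p, h0, h1, h2, h3, h4, h5⟩ :=
    (ballRivoal_integralPartialFraction 146 11 (2 * N)).exists_linear_form
    (fun t _ => ballRivoal_neg_sub 11 (by decide) (even_two_mul N) t)
    (ballRivoal_nonneg _ _ _) hle'
  have hσ : (0 : ℝ) ≤ ballRivoalRate ^ N := pow_nonneg (Rat.cast_nonneg.2 ballRivoalRate_nonneg) _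
  have hπ : (0 : ℝ) ≤ coeffRate ^ (2 * N) :=
    pow_nonneg (Rat.cast_nonneg.2 (zero_le_one.trans one_le_coeffRate)) _
  refine ⟨p₀, p, h0, h1, fun i hi => ?_, h3, h4 (by norm_num), ?_, ?_⟩
  · have : (|p i| : ℚ) ≤ A * coeffRate ^ (2 * N) := by rw [hA]; exact h2 i hi
    have : |(p i : ℝ)| ≤ A * coeffRate ^ (2 * N) := by exact_mod_cast (Rat.cast_le (K := ℝ)).2 this
    exact this.trans (by gcongr; linarith)
  · exact (Rat.cast_pos.2 (ballRivoal_pos 147 (le_refl (11 * (2 * N))))).trans_le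
      (le_hasSum h5 (11 * (2 * N)) fun k _ => Rat.cast_nonneg.2 (ballRivoal_nonneg _ _ _ k))
  · have h6 := ((zetaR_summable le_rfl).hasSum.mul_left (ballRivoalRate ^ N : ℝ))
    have h7 := hasSum_le (fun k => (hle' k).trans_eq (by ring)) h5 h6
    refine h7.trans ?_
    have hA0' : (0 : ℝ) ≤ A := Rat.cast_nonneg.2 hA0
    rw [mul_comm]
    change zetaR 2 * _ ≤ _
    gcongr
    linarith

theorem exists_common_den (α : ℕ → ℚ) (b : ℕ) :
    ∃ Q : ℕ, 0 < Q ∧ ∀ i < b, Q * α i ∈ (Int.castRingHom ℚ).range := by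
  refine ⟨∏ i ∈ range b, (α i).den, prod_pos fun i _ => (α i).den_pos, fun i hi => ?_⟩
  obtain ⟨c, hc⟩ := dvd_prod_of_mem (fun i => (α i).den) (mem_range.2 hi)
  refine ⟨c * (α i).num, ?_⟩
  rw [hc]
  push_cast
  rw [eq_intCast, Int.cast_mul, Int.cast_natCast, mul_right_comm, Rat.den_mul_eq_num, mul_comm]

theorem eventually_exists_zeta_three_form {α β : ℕ → ℚ}
    (hαβ : ∀ i < 169, 2 ≤ i → Even i → zetaR (i + 1) = α i + β i * zetaR 3) :
    ∃ B : ℝ, 0 ≤ B ∧ ∀ᶠ N : ℕ in atTop, ∃ u v : ℤ,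
      (Nat.lcmUpto (2 * N) : ℤ) ^ 3 ∣ v ∧
      |(v : ℝ)| ≤ B * (Nat.lcmUpto (2 * N) ^ 169 * coeffRate ^ (2 * N)) ∧
      0 < u + v * zetaR 3 ∧
      u + v * zetaR 3 ≤ B * (Nat.lcmUpto (2 * N) ^ 169 * ballRivoalRate ^ N) := by
  obtain ⟨Q₁, hQ₁, hα⟩ := exists_common_den α 169
  obtain ⟨Q₂, hQ₂, hβ⟩ := exists_common_den β 169
  obtain ⟨Q, hQ⟩ : ∃ Q, Q = Q₁ * Q₂ := ⟨_, rfl⟩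
  have hQ0 : 0 < Q := by rw [hQ]; positivity
  replace hα (i : ℕ) (hi : i < 169) : Q * α i ∈ (Int.castRingHom ℚ).range := by
    rw [hQ, mul_comm Q₁]; push_cast; rw [mul_assoc]
    exact mul_mem (natCast_mem_range _) (hα i hi)
  replace hβ (i : ℕ) (hi : i < 169) : Q * β i ∈ (Int.castRingHom ℚ).range := by
    rw [hQ]; push_cast; rw [mul_assoc]
    exact mul_mem (natCast_mem_range _) (hβ i hi)
  obtain ⟨B, hB, h⟩ := eventually_exists_ballRivoal_form
  have hβ0 : 0 ≤ ∑ i ∈ range 169, |(β i : ℝ)| := sum_nonneg fun i _ => abs_nonneg _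
  refine ⟨2 * Q * B * (1 + ∑ i ∈ range 169, |(β i : ℝ)|), by positivity, ?_⟩
  filter_upwards [h] with N ⟨p₀, p, h0, h1, h2, h3, h4, h5, h6⟩
  obtain ⟨d, hd⟩ : ∃ d, d = Nat.lcmUpto (2 * N) := ⟨_, rfl⟩
  rw [← hd] at h0 h1 ⊢
  have hσ : (0 : ℝ) ≤ ballRivoalRate ^ N := pow_nonneg (Rat.cast_nonneg.2 ballRivoalRate_nonneg) _
  have hp (i : ℕ) (hi : i < 169) (hne : p i ≠ 0) : 2 ≤ i ∧ Even i := by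
    have h7 : Even i := by
      by_contra h
      exact hne (h3 i hi (Nat.not_even_iff_odd.1 h))
    refine ⟨?_, h7⟩
    rcases h7 with ⟨k, rfl⟩
    rcases Nat.eq_zero_or_pos k with rfl | hk
    · exact absurd h4 hne
    · omega
  have hdpow (i : ℕ) (hi : i < 169) (h2i : 2 ≤ i) :
      (d : ℚ) ^ 169 = d ^ 3 * d ^ (i - 2) * d ^ (168 - i) := by
    rw [← pow_add, ← pow_add]; congr 1; omega
  have hterm {γ : ℕ → ℚ} (hγ : ∀ i < 169, Q * γ i ∈ (Int.castRingHom ℚ).range) :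
      2 * (d : ℚ) ^ 169 * Q * ∑ i ∈ range 169, γ i * p i ∈
        (Int.castRingHom ℚ).range.toAddSubgroup.map (AddMonoidHom.mulLeft ((d : ℚ) ^ 3)) := by
    rw [mul_sum]
    refine sum_mem fun i hi => ?_
    rw [mem_range] at hi
    rcases eq_or_ne (p i) 0 with h | h
    · rw [h]; simp only [mul_zero]; exact zero_mem _
    · refine ⟨Q * γ i * d ^ (i - 2) * (2 * d ^ (168 - i) * p i), ?_, ?_⟩
      · exact Subring.mul_mem _ (Subring.mul_mem _ (hγ i hi)
          (Subring.pow_mem _ (natCast_mem_range _) _)) (h1 i hi)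
      · rw [AddMonoidHom.coe_mulLeft, hdpow i hi (hp i hi h).1]
        ring
  obtain ⟨_, ⟨v, rfl⟩, hv⟩ := hterm hβ
  obtain ⟨_, ⟨u, rfl⟩, hu⟩ := hterm hα
  obtain ⟨u₀, hu₀⟩ := h0
  rw [AddMonoidHom.coe_mulLeft, eq_intCast] at hv hu
  rw [eq_intCast] at hu₀
  have hvR : (d ^ 3 * v : ℝ) = 2 * (d : ℝ) ^ 169 * Q * ∑ i ∈ range 169, (β i * p i : ℝ) := by
    exact_mod_cast congrArg (Rat.cast : ℚ → ℝ) hv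
  have huR : (d ^ 3 * u : ℝ) = 2 * (d : ℝ) ^ 169 * Q * ∑ i ∈ range 169, (α i * p i : ℝ) := by
    exact_mod_cast congrArg (Rat.cast : ℚ → ℝ) hu
  have huR₀ : (u₀ : ℝ) = 2 * (d : ℝ) ^ 169 * p₀ := by
    exact_mod_cast congrArg (Rat.cast : ℚ → ℝ) hu₀
  have hform : ((Q * u₀ + d ^ 3 * u : ℤ) : ℝ) + (d ^ 3 * v : ℤ) * zetaR 3 =
      2 * d ^ 169 * Q * (p₀ + ∑ i ∈ range 169, p i * zetaR (i + 1)) := by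
    have : ∑ i ∈ range 169, p i * zetaR (i + 1) =
        ∑ i ∈ range 169, (α i * p i : ℝ) + (∑ i ∈ range 169, (β i * p i : ℝ)) * zetaR 3 := by
      rw [sum_mul, ← sum_add_distrib]
      refine sum_congr rfl fun i hi => ?_
      rw [mem_range] at hi
      rcases eq_or_ne (p i) 0 with h | h
      · simp [h]
      · rw [hαβ i hi (hp i hi h).1 (hp i hi h).2]; ring
    push_cast
    rw [this, huR, hvR, huR₀]
    ring
  have hd0 : 0 < d := by rw [hd]; exact Nat.lcmUpto_pos _
  refine ⟨Q * u₀ + d ^ 3 * u, d ^ 3 * v, dvd_mul_right _ _, ?_, ?_, ?_⟩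
  · push_cast
    rw [hvR, abs_mul, abs_of_nonneg (show 0 ≤ 2 * (d : ℝ) ^ 169 * Q by positivity)]
    have h7 : |∑ i ∈ range 169, (β i * p i : ℝ)| ≤
        (∑ i ∈ range 169, |(β i : ℝ)|) * (B * coeffRate ^ (2 * N)) := by
      refine (abs_sum_le_sum_abs _ _).trans ?_
      rw [sum_mul]
      refine sum_le_sum fun i hi => ?_
      rw [abs_mul]
      exact mul_le_mul_of_nonneg_left (h2 i (mem_range.1 hi)) (abs_nonneg _)
    have h8 : 0 ≤ B * (coeffRate : ℝ) ^ (2 * N) := (abs_nonneg _).trans (h2 0 (by norm_num))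
    calc _ ≤ 2 * (d : ℝ) ^ 169 * Q * ((1 + ∑ i ∈ range 169, |(β i : ℝ)|) *
          (B * coeffRate ^ (2 * N))) := by
          gcongr
          refine h7.trans ?_
          gcongr
          linarith
      _ = _ := by ring
  · rw [hform]; positivity
  · rw [hform]
    calc _ ≤ 2 * (d : ℝ) ^ 169 * Q * (B * ballRivoalRate ^ N) := by gcongr
      _ = 2 * Q * B * 1 * (d ^ 169 * ballRivoalRate ^ N) := by ring
      _ ≤ _ := by gcongr; linarith

theorem not_forall_zeta_mem_span_zeta_three {α β : ℕ → ℚ}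
    (hαβ : ∀ i < 169, 2 ≤ i → Even i → zetaR (i + 1) = α i + β i * zetaR 3) : False := by
  obtain ⟨B, hB, h⟩ := eventually_exists_zeta_three_form hαβ
  have hd := (tendsto_id.const_mul_atTop' (zero_lt_two (α := ℕ))).eventually
    (eventually_lcmUpto_le_pow (C := 2.72)
      (by have := Real.exp_one_lt_d9; norm_num at this ⊢; linarith))
  obtain ⟨N₀, hN₀⟩ := eventually_atTop.1 (h.and hd)
  obtain ⟨σ, hσd⟩ : ∃ σ : ℝ, σ = ballRivoalRate := ⟨_, rfl⟩
  obtain ⟨π, hπd⟩ : ∃ π : ℝ, π = coeffRate := ⟨_, rfl⟩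
  obtain ⟨C, hCd⟩ : ∃ C : ℝ, C = 2.72 := ⟨_, rfl⟩
  have hσ : 0 ≤ σ := by rw [hσd]; exact_mod_cast ballRivoalRate_nonneg
  have hπ : 1 ≤ π := by rw [hπd]; exact_mod_cast one_le_coeffRate
  have hC : 1 ≤ C := by rw [hCd]; norm_num
  have hθ : σ * π ^ 2 * C ^ 670 < 1 := by
    have h1 : ((ballRivoalRate * coeffRate ^ 2 * 2.72 ^ 670 : ℚ) : ℝ) < ((1 : ℚ) : ℝ) :=
      Rat.cast_lt.2 ballRivoalRate_mul_lt_one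
    rw [hσd, hπd, hCd]
    push_cast at h1
    exact h1
  have hθ' : σ * C ^ 338 < 1 := by
    refine lt_of_le_of_lt ?_ hθ
    calc σ * C ^ 338 = σ * 1 ^ 2 * C ^ 338 := by ring
      _ ≤ σ * π ^ 2 * C ^ 670 := by gcongr; norm_num
  simp only [← hσd, ← hπd, ← hCd, id] at hN₀
  obtain ⟨d, hdd⟩ : ∃ d : ℕ → ℕ, d = fun n => Nat.lcmUpto (2 * (n + N₀)) := ⟨_, rfl⟩
  have hd0 (n : ℕ) : 0 < d n := by rw [hdd]; exact Nat.lcmUpto_pos _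
  have hdC (n : ℕ) : (d n : ℝ) ≤ C ^ (2 * (n + N₀)) := by
    rw [hdd]; exact (hN₀ (n + N₀) (by omega)).2
  have hdvd (n : ℕ) : d n ∣ d (n + 1) := by
    rw [hdd]
    exact Finset.lcm_mono (Finset.Icc_subset_Icc_right (by omega))
  choose u v hv hvB hpos hle using fun n => (hN₀ (n + N₀) (by omega)).1
  have hdn (n : ℕ) : Nat.lcmUpto (2 * (n + N₀)) = d n := by rw [hdd]
  simp only [hdn] at hv hvB hle
  refine false_of_small_linear_forms (u := u) (v := v) (D := fun n => (d n : ℤ) ^ 3)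
    (Eventually.of_forall fun n => (hpos n).ne') ?_ hv
    (fun n => (pow_dvd_pow_of_dvd (Int.natCast_dvd_natCast.2 (hdvd n)) 3).trans (hv (n + 1))) ?_
  · refine squeeze_zero (g := fun n => B * (σ * C ^ 338) ^ (n + N₀)) (fun n => (hpos n).le)
      (fun n => (hle n).trans ?_) ?_
    · calc B * ((d n : ℝ) ^ 169 * σ ^ (n + N₀))
          ≤ B * ((C ^ (2 * (n + N₀))) ^ 169 * σ ^ (n + N₀)) := by gcongr; exact hdC n
        _ = _ := by ring
    · rw [← mul_zero B]
      exact ((tendsto_add_atTop_iff_nat N₀).2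
        (tendsto_pow_atTop_nhds_zero_of_lt_one (by positivity) hθ')).const_mul B
  · obtain ⟨A, hA⟩ : ∃ A, A = B ^ 2 * C ^ 338 * (π ^ 2 + σ) := ⟨_, rfl⟩
    have hlim : Tendsto (fun n => A * (σ * π ^ 2 * C ^ 670) ^ (n + N₀)) atTop (𝓝 (A * 0)) :=
      ((tendsto_add_atTop_iff_nat N₀).2
        (tendsto_pow_atTop_nhds_zero_of_lt_one (by positivity) hθ)).const_mul A
    rw [mul_zero] at hlim
    filter_upwards [hlim.eventually_lt_const zero_lt_one] with n hn
    have hd1 : (0 : ℝ) < d n := by exact_mod_cast hd0 n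
    rw [abs_mul, abs_mul, abs_of_pos (hpos n), abs_of_pos (hpos (n + 1))]
    push_cast
    obtain ⟨m, hm⟩ : ∃ m, m = n + N₀ := ⟨_, rfl⟩
    have hm' : n + 1 + N₀ = m + 1 := by omega
    have h1 := hle n
    have h2 := hle (n + 1)
    have h3 := hvB n
    have h4 := hvB (n + 1)
    have h5 := hdC n
    have h6 := hdC (n + 1)
    have h7 := (hpos n).le
    have h8 := (hpos (n + 1)).le
    rw [hm'] at h2 h4 h6
    rw [← hm] at h1 h3 h5 hn
    calc _ ≤ B * ((d n : ℝ) ^ 169 * σ ^ m) * (B * (d (n + 1) ^ 169 * π ^ (2 * (m + 1)))) +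
        B * ((d (n + 1) : ℝ) ^ 169 * σ ^ (m + 1)) * (B * (d n ^ 169 * π ^ (2 * m))) :=
          add_le_add (mul_le_mul h1 h4 (abs_nonneg _) (h7.trans h1))
            (mul_le_mul h2 h3 (abs_nonneg _) (h8.trans h2))
      _ = d n ^ 3 * (B ^ 2 * (d n ^ 166 * d (n + 1) ^ 169 * (σ ^ m * π ^ (2 * m) * (π ^ 2 + σ)))) :=
          by ring
      _ ≤ d n ^ 3 * (B ^ 2 * ((C ^ (2 * m)) ^ 166 * (C ^ (2 * (m + 1))) ^ 169 *
          (σ ^ m * π ^ (2 * m) * (π ^ 2 + σ)))) := by gcongr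
      _ = d n ^ 3 * (A * (σ * π ^ 2 * C ^ 670) ^ m) := by rw [hA]; ring
      _ < d n ^ 3 * 1 := by gcongr
      _ = _ := mul_one _

theorem linearIndependent_one_zetaR_three :
    LinearIndependent ℚ ![(1 : ℝ), zetaR 3] := by
  rw [LinearIndependent.pair_iff]
  intro s t h
  have ht : t = 0 := by
    by_contra ht
    refine irrational_zetaR_three ⟨-s / t, ?_⟩
    have ht' : (t : ℝ) ≠ 0 := by exact_mod_cast ht
    push_cast
    rw [div_eq_iff ht']
    simp only [Rat.smul_def] at h
    linarith
  refine ⟨?_, ht⟩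
  simpa [ht, Rat.smul_def] using h

theorem exists_eq_add_mul_of_not_linearIndependent {x y : ℝ}
    (hx : LinearIndependent ℚ ![(1 : ℝ), x]) (h : ¬ LinearIndependent ℚ ![(1 : ℝ), x, y]) :
    ∃ α β : ℚ, y = α + β * x := by
  by_contra! hne
  refine h ?_
  rw [LinearIndependent.pair_iff] at hx
  rw [Fintype.linearIndependent_iff]
  intro g hg
  simp only [Fin.sum_univ_three, Rat.smul_def, Matrix.cons_val] at hg
  have h2 : g 2 = 0 := by
    by_contra h2
    refine hne (-g 0 / g 2) (-g 1 / g 2) ?_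
    have : (g 2 : ℝ) ≠ 0 := by exact_mod_cast h2
    push_cast
    field_simp
    linarith
  obtain ⟨h0, h1⟩ := hx (g 0) (g 1) (by simp only [Rat.smul_def]; simpa [h2] using hg)
  intro i
  fin_cases i <;> assumption

end

/-- (Ball–Rivoal) There is an odd integer `ℓ` with `5 ≤ ℓ ≤ 169` such that
`1, ζ(3), ζ(ℓ)` are linearly independent over ℚ. -/
theorem ball_rivoal_169 :
    ∃ ℓ : ℕ, Odd ℓ ∧ 5 ≤ ℓ ∧ ℓ ≤ 169 ∧
      LinearIndependent ℚ ![(1 : ℝ), zetaR 3, zetaR ℓ] := by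
  by_contra! h
  have h1 (i : ℕ) : ∃ α β : ℚ, i < 169 → 2 ≤ i → Even i → zetaR (i + 1) = α + β * zetaR 3 := by
    by_cases hi : i < 169 ∧ 4 ≤ i ∧ Even i
    · obtain ⟨α, β, h⟩ := exists_eq_add_mul_of_not_linearIndependent
        linearIndependent_one_zetaR_three
        (h (i + 1) hi.2.2.add_one (by omega) (by omega))
      exact ⟨α, β, fun _ _ _ => h⟩
    · refine ⟨0, 1, fun h2 h3 h4 => ?_⟩
      have : i = 2 := by
        by_contra h5
        obtain ⟨k, rfl⟩ := h4
        exact hi ⟨h2, by omega, ⟨k, rfl⟩⟩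
      subst this
      simp
  choose α β h2 using h1
  exact not_forall_zeta_mem_span_zeta_three h2
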